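/- For every real x > 0, with q = e^{−πx/√8} and α = φ(−q²)²/φ(q²)², one has F_{(2,2)}(x) = (9π²/(256x)) · ∫_α^1 (3u−1)/√(u(1−u)) · ₂F₁(1/2,1/2;1;1−u²) du, where the integral is over the real interval [α,1] and 0 < α < 1. -/

import Mathlib

open Real Filter Topology

/-- The two-dimensional lattice sum `F_{(2,2)}(x)`. -/
noncomputable def F22 (x : ℝ) : ℝ :=
  9 * ∑' p : ℕ × ℕ, (-1:ℝ)^(p.1*(p.1+1)/2 + p.2) * (2*(p.2:ℝ)+1) /
    (2*(2*(p.2:ℝ)+1)^2 + x^2*(2*(p.1:ℝ)+1)^2)^2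

/-- Ramanujan's theta function `φ(q) = Σ_{n∈ℤ} q^{n²}` (real argument). -/
noncomputable def phiR (q : ℝ) : ℝ := ∑' n : ℤ, q^(n^2)

/-- The Pochhammer symbol `(a)_n`. -/
noncomputable def poch (a : ℝ) (n : ℕ) : ℝ := ∏ i ∈ Finset.range n, (a + i)

/-- The Gauss hypergeometric function `₂F₁(1/2,1/2;1;z)`. -/
noncomputable def hyp2F1half (z : ℝ) : ℝ :=
  ∑' n : ℕ, (poch (1/2) n / (n.factorial : ℝ))^2 * z^n

/-- The Taylor coefficients of `(1 - t)^(-1/2)`. -/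
noncomputable def invSqrtCoeff (n : ℕ) : ℝ := poch (1/2) n / (n.factorial : ℝ)

lemma invSqrtCoeff_zero : invSqrtCoeff 0 = 1 := by simp [invSqrtCoeff, poch]

lemma invSqrtCoeff_succ (n : ℕ) :
    ((n:ℝ) + 1) * invSqrtCoeff (n + 1) = ((n:ℝ) + 1/2) * invSqrtCoeff n := by
  have h : ((n.factorial : ℕ) : ℝ) ≠ 0 := by positivity
  simp only [invSqrtCoeff, poch, Finset.prod_range_succ, Nat.factorial_succ]
  push_cast
  field_simp
  ring

lemma invSqrtCoeff_eq_prod (n : ℕ) :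
    invSqrtCoeff n = ∏ i ∈ Finset.range n, (2 * (i:ℝ) + 1) / (2 * i + 2) := by
  induction n with
  | zero => simp [invSqrtCoeff_zero]
  | succ n ih =>
    rw [Finset.prod_range_succ, ← ih]
    have := invSqrtCoeff_succ n
    field_simp
    linarith

lemma invSqrtCoeff_nonneg (n : ℕ) : 0 ≤ invSqrtCoeff n := by
  rw [invSqrtCoeff_eq_prod]; positivity

lemma invSqrtCoeff_le_one (n : ℕ) : invSqrtCoeff n ≤ 1 := by
  rw [invSqrtCoeff_eq_prod]
  refine Finset.prod_le_one (fun i _ => by positivity) (fun i _ => ?_)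
  rw [div_le_one (by positivity)]
  linarith

lemma sum_antidiagonal_invSqrtCoeff (n : ℕ) :
    ∑ p ∈ Finset.HasAntidiagonal.antidiagonal n, invSqrtCoeff p.1 * invSqrtCoeff p.2 = 1 := by
  induction n with
  | zero => simp [invSqrtCoeff_zero]
  | succ n ih =>
    set c := invSqrtCoeff
    have key : ∑ p ∈ Finset.HasAntidiagonal.antidiagonal (n+1), (p.1:ℝ) * (c p.1 * c p.2)
        = ∑ p ∈ Finset.HasAntidiagonal.antidiagonal n, ((p.1:ℝ) + 1/2) * (c p.1 * c p.2) := by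
      rw [Finset.Nat.sum_antidiagonal_succ]
      simp only [Nat.cast_zero, zero_mul, zero_add, Nat.cast_add, Nat.cast_one]
      refine Finset.sum_congr rfl fun p _ => ?_
      rw [← mul_assoc, invSqrtCoeff_succ, mul_assoc]
    have symm (m : ℕ) : 2 * ∑ p ∈ Finset.HasAntidiagonal.antidiagonal m, (p.1:ℝ) * (c p.1 * c p.2)
        = m * ∑ p ∈ Finset.HasAntidiagonal.antidiagonal m, c p.1 * c p.2 := by
      have h : ∑ p ∈ Finset.HasAntidiagonal.antidiagonal m, (p.1:ℝ) * (c p.1 * c p.2)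
          = ∑ p ∈ Finset.HasAntidiagonal.antidiagonal m, (p.2:ℝ) * (c p.1 * c p.2) := by
        rw [← Finset.Nat.sum_antidiagonal_swap]
        refine Finset.sum_congr rfl fun p _ => ?_
        simp only [Prod.fst_swap, Prod.snd_swap]; ring
      rw [two_mul]
      nth_rewrite 2 [h]
      rw [← Finset.sum_add_distrib, Finset.mul_sum]
      refine Finset.sum_congr rfl fun p hp => ?_
      rw [← Finset.HasAntidiagonal.mem_antidiagonal.mp hp]; push_cast; ring
    have h1 := symm (n+1)
    have h2 := symm n
    simp only [add_mul, Finset.sum_add_distrib] at key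
    rw [← Finset.mul_sum, ih] at key
    rw [ih] at h2
    rw [key] at h1
    push_cast at h1
    have h3 : ((n:ℝ)+1) ≠ 0 := by positivity
    apply mul_left_cancel₀ h3
    linarith

lemma summable_norm_invSqrtCoeff_mul_pow {z : ℂ} (hz : ‖z‖ < 1) :
    Summable fun n => ‖(invSqrtCoeff n : ℂ) * z ^ n‖ := by
  refine Summable.of_nonneg_of_le (fun _ => norm_nonneg _) (fun n => ?_)
    (summable_geometric_of_lt_one (norm_nonneg z) hz)
  rw [norm_mul, norm_pow, Complex.norm_real, Real.norm_of_nonneg (invSqrtCoeff_nonneg n)]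
  exact mul_le_of_le_one_left (by positivity) (invSqrtCoeff_le_one n)

lemma tsum_invSqrtCoeff_sq {z : ℂ} (hz : ‖z‖ < 1) :
    (∑' n, (invSqrtCoeff n : ℂ) * z ^ n) ^ 2 = (1 - z)⁻¹ := by
  have hs := summable_norm_invSqrtCoeff_mul_pow hz
  rw [sq, tsum_mul_tsum_eq_tsum_sum_antidiagonal_of_summable_norm hs hs,
    ← tsum_geometric_of_norm_lt_one hz]
  refine tsum_congr fun n => ?_
  have := sum_antidiagonal_invSqrtCoeff n
  calc _ = ∑ p ∈ Finset.HasAntidiagonal.antidiagonal n,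
        ((invSqrtCoeff p.1 * invSqrtCoeff p.2 : ℝ) : ℂ) * z ^ n := by
        refine Finset.sum_congr rfl fun p hp => ?_
        rw [← Finset.HasAntidiagonal.mem_antidiagonal.mp hp]; push_cast; ring
    _ = z ^ n := by rw [← Finset.sum_mul, ← Complex.ofReal_sum, this]; simp

lemma tsum_invSqrtCoeff_real {t : ℝ} (h0 : 0 ≤ t) (h1 : t < 1) :
    ∑' n, invSqrtCoeff n * t ^ n = 1 / √(1 - t) := by
  have hz : ‖(t:ℂ)‖ < 1 := by rwa [Complex.norm_real, Real.norm_of_nonneg h0]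
  have h := tsum_invSqrtCoeff_sq hz
  have h' : (∑' n, invSqrtCoeff n * t ^ n) ^ 2 = (1 - t)⁻¹ := by
    exact_mod_cast h
  have hp : 0 ≤ ∑' n, invSqrtCoeff n * t ^ n :=
    tsum_nonneg fun n => mul_nonneg (invSqrtCoeff_nonneg n) (pow_nonneg h0 n)
  rw [← Real.sqrt_sq hp, h', Real.sqrt_inv, one_div]

/-- The complete elliptic integral as a hypergeometric series. -/
lemma integral_inv_sqrt_eq_hyp {k : ℝ} (h0 : 0 ≤ k) (h1 : k < 1) :
    ∫ t in (0:ℝ)..π, 1 / √(1 - k * Real.sin t ^ 2) = π * hyp2F1half k := by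
  have hsum : HasSum (fun n : ℕ => ∫ t in (0:ℝ)..π, invSqrtCoeff n * (k * Real.sin t ^ 2) ^ n)
      (∫ t in (0:ℝ)..π, ∑' n : ℕ, invSqrtCoeff n * (k * Real.sin t ^ 2) ^ n) := by
    refine intervalIntegral.hasSum_integral_of_dominated_convergence
      (bound := fun n _ => k ^ n) (fun n => ?_) (fun n => ?_) ?_ ?_ ?_
    · exact (by fun_prop : Continuous _).aestronglyMeasurable
    · refine Eventually.of_forall fun t _ => ?_
      have hst : Real.sin t ^ 2 ≤ 1 := Real.sin_sq_le_one t
      rw [norm_mul, Real.norm_of_nonneg (invSqrtCoeff_nonneg n), norm_pow,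
        Real.norm_of_nonneg (by positivity)]
      calc _ ≤ 1 * k ^ n := by
            gcongr
            · exact invSqrtCoeff_le_one n
            · nlinarith
        _ = _ := one_mul _
    · exact Eventually.of_forall fun t _ => summable_geometric_of_lt_one h0 h1
    · exact intervalIntegrable_const
    · refine Eventually.of_forall fun t _ => Summable.hasSum ?_
      have hst : Real.sin t ^ 2 ≤ 1 := Real.sin_sq_le_one t
      refine Summable.of_nonneg_of_le (fun n => mul_nonneg (invSqrtCoeff_nonneg n) (by positivity))
        (fun n => ?_) (summable_geometric_of_lt_one h0 h1)
      calc _ ≤ 1 * k ^ n := by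
            gcongr
            · exact invSqrtCoeff_le_one n
            · nlinarith
        _ = _ := one_mul _
  have e1 : ∀ t : ℝ, ∑' n : ℕ, invSqrtCoeff n * (k * Real.sin t ^ 2) ^ n
      = 1 / √(1 - k * Real.sin t ^ 2) := fun t => by
    have hst : Real.sin t ^ 2 ≤ 1 := Real.sin_sq_le_one t
    exact tsum_invSqrtCoeff_real (by positivity) (by nlinarith)
  simp only [e1] at hsum
  rw [← hsum.tsum_eq, hyp2F1half, ← tsum_mul_left]
  refine tsum_congr fun n => ?_
  have : ∀ t : ℝ, invSqrtCoeff n * (k * Real.sin t ^ 2) ^ n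
      = (invSqrtCoeff n * k ^ n) * Real.sin t ^ (2 * n) := fun t => by
    rw [pow_mul]; ring
  simp only [this]
  rw [intervalIntegral.integral_const_mul, integral_sin_pow_even, ← invSqrtCoeff_eq_prod,
    ← invSqrtCoeff]
  ring

lemma integral_cexp_two_mul (n m : ℕ) :
    ∫ t in (0:ℝ)..π, Complex.exp (2 * Complex.I * t) ^ n
      * (starRingEnd ℂ) (Complex.exp (2 * Complex.I * t)) ^ m = if n = m then (π:ℂ) else 0 := by
  have e (t : ℝ) : Complex.exp (2 * Complex.I * t) ^ n
      * (starRingEnd ℂ) (Complex.exp (2 * Complex.I * t)) ^ m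
      = Complex.exp ((2 * Complex.I * ((n:ℂ) - m)) * t) := by
    rw [← Complex.exp_conj, ← Complex.exp_nat_mul, ← Complex.exp_nat_mul, ← Complex.exp_add]
    congr 1
    simp only [map_mul, Complex.conj_I, Complex.conj_ofReal, map_ofNat]
    ring
  simp only [e]
  split_ifs with h
  · simp [h]
  · have hne : (2 * Complex.I * ((n:ℂ) - m)) ≠ 0 := by
      have : (n:ℂ) - m ≠ 0 := sub_ne_zero.mpr (by exact_mod_cast h)
      simp [this]
    rw [integral_exp_mul_complex hne]
    have : Complex.exp ((2 * Complex.I * ((n:ℂ) - m)) * (π:ℝ)) = 1 := by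
      have := Complex.exp_int_mul_two_pi_mul_I ((n:ℤ) - m)
      rw [← this]; congr 1; push_cast; ring
    rw [this]; simp

/-- Parseval for `(1 + x e^{2it})^(-1/2)`. -/
lemma integral_inv_norm_eq_hyp {x : ℝ} (h0 : 0 ≤ x) (h1 : x < 1) :
    ∫ t in (0:ℝ)..π, 1 / √((1 + x) ^ 2 - 4 * x * Real.sin t ^ 2) = π * hyp2F1half (x ^ 2) := by
  set E : ℝ → ℂ := fun t => Complex.exp (2 * Complex.I * t) with hE
  have hEn (t : ℝ) : ‖E t‖ = 1 := by
    simp only [hE]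
    rw [show 2 * Complex.I * (t:ℂ) = ((2 * t : ℝ) : ℂ) * Complex.I by push_cast; ring]
    exact Complex.norm_exp_ofReal_mul_I _
  have hEc : Continuous E := by fun_prop
  set g : ℝ → ℂ := fun t => ∑' n : ℕ, (invSqrtCoeff n : ℂ) * ((-x : ℂ) * E t) ^ n with hg
  have hzn (t : ℝ) : ‖(-x : ℂ) * E t‖ < 1 := by
    rw [norm_mul, hEn, norm_neg, Complex.norm_real, Real.norm_of_nonneg h0]; simpa using h1
  have hgsq (t : ℝ) : g t * (starRingEnd ℂ) (g t)
      = ((1 / √((1 + x) ^ 2 - 4 * x * Real.sin t ^ 2) : ℝ) : ℂ) := by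
    have h2 := tsum_invSqrtCoeff_sq (hzn t)
    rw [Complex.mul_conj, Complex.normSq_eq_norm_sq, ← norm_pow, h2, norm_inv, one_div]
    congr 2
    rw [← Real.sqrt_sq (norm_nonneg _), ← Complex.normSq_eq_norm_sq]
    congr 1
    have : (1 : ℂ) - -x * E t
        = ((1 + x * Real.cos (2 * t) : ℝ) : ℂ) + ((x * Real.sin (2 * t) : ℝ) : ℂ) * Complex.I := by
      simp only [hE]
      rw [show 2 * Complex.I * (t:ℂ) = ((2 * t : ℝ) : ℂ) * Complex.I by push_cast; ring,
        Complex.exp_mul_I]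
      push_cast; ring
    rw [this, Complex.normSq_add_mul_I, Real.cos_two_mul, Real.sin_two_mul, Real.sin_sq]
    have := Real.sin_sq_add_cos_sq t
    have h4 : Real.sin t ^ 2 = 1 - Real.cos t ^ 2 := by linarith
    ring_nf
    rw [h4]; ring
  set F : ℕ × ℕ → ℝ → ℂ := fun p t =>
    ((invSqrtCoeff p.1 : ℂ) * ((-x : ℂ) * E t) ^ p.1) *
      (starRingEnd ℂ) ((invSqrtCoeff p.2 : ℂ) * ((-x : ℂ) * E t) ^ p.2) with hF
  have hb (n : ℕ) (t : ℝ) : ‖(invSqrtCoeff n : ℂ) * ((-x : ℂ) * E t) ^ n‖ ≤ x ^ n := by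
    rw [norm_mul, norm_pow, norm_mul, hEn, norm_neg, Complex.norm_real, Complex.norm_real,
      Real.norm_of_nonneg h0, Real.norm_of_nonneg (invSqrtCoeff_nonneg n), mul_one]
    exact mul_le_of_le_one_left (by positivity) (invSqrtCoeff_le_one n)
  have hFb (p : ℕ × ℕ) (t : ℝ) : ‖F p t‖ ≤ x ^ p.1 * x ^ p.2 := by
    simp only [hF]
    rw [norm_mul, RCLike.norm_conj]
    exact mul_le_mul (hb _ _) (hb _ _) (norm_nonneg _) (by positivity)
  have hgeo := summable_geometric_of_lt_one h0 h1
  have hgeo2 : Summable fun p : ℕ × ℕ => x ^ p.1 * x ^ p.2 :=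
    hgeo.mul_of_nonneg hgeo (fun n => pow_nonneg h0 n) (fun n => pow_nonneg h0 n)
  have hsum : HasSum (fun p : ℕ × ℕ => ∫ t in (0:ℝ)..π, F p t)
      (∫ t in (0:ℝ)..π, g t * (starRingEnd ℂ) (g t)) := by
    refine intervalIntegral.hasSum_integral_of_dominated_convergence
      (bound := fun p _ => x ^ p.1 * x ^ p.2) (fun p => ?_) (fun p => ?_) ?_ ?_ ?_
    · refine Continuous.aestronglyMeasurable ?_
      simp only [hF]
      exact (by fun_prop : Continuous _).mul (Complex.continuous_conj.comp (by fun_prop))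
    · exact Eventually.of_forall fun t _ => hFb p t
    · exact Eventually.of_forall fun t _ => hgeo2
    · exact intervalIntegrable_const
    · refine Eventually.of_forall fun t _ => ?_
      have hs : Summable fun n : ℕ => ‖(invSqrtCoeff n : ℂ) * ((-x : ℂ) * E t) ^ n‖ :=
        Summable.of_nonneg_of_le (fun _ => norm_nonneg _) (fun n => hb n t) hgeo
      have hs' : Summable fun n : ℕ =>
          ‖(starRingEnd ℂ) ((invSqrtCoeff n : ℂ) * ((-x : ℂ) * E t) ^ n)‖ := by
        simpa only [RCLike.norm_conj] using hs
      have hc := tsum_mul_tsum_of_summable_norm hs hs'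
      have hc2 : (starRingEnd ℂ) (g t)
          = ∑' n : ℕ, (starRingEnd ℂ) ((invSqrtCoeff n : ℂ) * ((-x : ℂ) * E t) ^ n) := by
        simp only [hg]; exact Complex.conj_tsum _
      rw [hc2, hc]
      exact (Summable.of_norm_bounded hgeo2 (fun p => hFb p t)).hasSum
  have hI (p : ℕ × ℕ) : ∫ t in (0:ℝ)..π, F p t
      = if p.1 = p.2 then ((π * (invSqrtCoeff p.1 ^ 2 * (x ^ 2) ^ p.1) : ℝ) : ℂ) else 0 := by
    have e (t : ℝ) : F p t = ((invSqrtCoeff p.1 : ℂ) * (-x) ^ p.1 * ((invSqrtCoeff p.2 : ℂ)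
        * (-x) ^ p.2)) * (E t ^ p.1 * (starRingEnd ℂ) (E t) ^ p.2) := by
      simp only [hF, map_mul, map_pow, map_neg, Complex.conj_ofReal, mul_pow]; ring
    simp only [e]
    rw [intervalIntegral.integral_const_mul, integral_cexp_two_mul]
    split_ifs with h
    · rw [← h]; push_cast
      rw [show ((x:ℂ) ^ 2) = (-x) * (-x) by ring, mul_pow]; ring
    · simp
  have hdiag : HasSum (fun n : ℕ => ((π * (invSqrtCoeff n ^ 2 * (x ^ 2) ^ n) : ℝ) : ℂ))
      (∫ t in (0:ℝ)..π, g t * (starRingEnd ℂ) (g t)) := by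
    have hinj : Function.Injective (fun n : ℕ => (n, n)) := fun a b h => (Prod.ext_iff.mp h).1
    have := (hinj.hasSum_iff (f := fun p : ℕ × ℕ => ∫ t in (0:ℝ)..π, F p t) ?_).mpr hsum
    · convert this using 2 with n
      simp [hI]
    · rintro ⟨a, b⟩ hab
      rw [hI, if_neg]
      intro h; simp only at h; subst h
      exact hab ⟨a, rfl⟩
  simp only [hgsq] at hdiag
  rw [intervalIntegral.integral_ofReal] at hdiag
  have := (Complex.hasSum_ofReal.mp hdiag).tsum_eq
  rw [← this, tsum_mul_left]
  rfl

/-- Landen's transformation. -/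
lemma hyp2F1half_landen {u : ℝ} (h0 : 0 < u) (h1 : u ≤ 1) :
    hyp2F1half (1 - u ^ 2) = 2 / (1 + u) * hyp2F1half (((1 - u) / (1 + u)) ^ 2) := by
  set x := (1 - u) / (1 + u) with hx
  have hx0 : 0 ≤ x := div_nonneg (by linarith) (by linarith)
  have hx1 : x < 1 := by rw [hx, div_lt_one (by linarith)]; linarith
  have hxu : 1 + x = 2 / (1 + u) := by rw [hx]; field_simp; ring
  have e : 4 * x = (1 - u ^ 2) * (1 + x) ^ 2 := by rw [hxu, hx]; field_simp; ring
  have A := integral_inv_norm_eq_hyp hx0 hx1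
  have B := integral_inv_sqrt_eq_hyp (k := 1 - u ^ 2) (by nlinarith) (by nlinarith)
  have h (t : ℝ) : 1 / √((1 + x) ^ 2 - 4 * x * Real.sin t ^ 2)
      = (1 + x)⁻¹ * (1 / √(1 - (1 - u ^ 2) * Real.sin t ^ 2)) := by
    rw [e, show (1 + x) ^ 2 - (1 - u ^ 2) * (1 + x) ^ 2 * Real.sin t ^ 2
      = (1 + x) ^ 2 * (1 - (1 - u ^ 2) * Real.sin t ^ 2) by ring,
      Real.sqrt_mul (by positivity), Real.sqrt_sq (by positivity)]
    rw [one_div, mul_inv, one_div]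
  simp only [h] at A
  rw [intervalIntegral.integral_const_mul, B] at A
  rw [← hxu]
  have hp := Real.pi_ne_zero
  have hne : 1 + x ≠ 0 := by positivity
  field_simp at A
  linarith

/-- The hyperbolic secant. -/
noncomputable def sech (t : ℝ) : ℝ := (Real.cosh t)⁻¹

lemma sech_pos (t : ℝ) : 0 < sech t := inv_pos.mpr (Real.cosh_pos t)

lemma sech_neg (t : ℝ) : sech (-t) = sech t := by simp [sech]

lemma sech_zero : sech 0 = 1 := by simp [sech]

lemma exp_abs_le_two_mul_cosh (t : ℝ) : Real.exp |t| ≤ 2 * Real.cosh t := by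
  rw [← Real.cosh_abs t, Real.cosh_eq]
  have := Real.exp_pos (-|t|)
  linarith

lemma sech_le (t : ℝ) : sech t ≤ 2 * Real.exp (-|t|) := by
  rw [sech, Real.exp_neg, inv_le_comm₀ (Real.cosh_pos t) (by positivity), mul_inv, inv_inv]
  have := exp_abs_le_two_mul_cosh t
  linarith

lemma sech_le_one (t : ℝ) : sech t ≤ 1 := inv_le_one_of_one_le₀ (Real.one_le_cosh t)

/-- Functions decaying like `exp (-|t|)`. -/
def ExpDecay (f : ℝ → ℝ) : Prop := ∃ C : ℝ, 0 ≤ C ∧ ∀ t, |f t| ≤ C * Real.exp (-|t|)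

lemma expDecay_sech : ExpDecay sech :=
  ⟨2, by norm_num, fun t => by rw [abs_of_pos (sech_pos t)]; exact sech_le t⟩

lemma ExpDecay.mul_bounded {f g : ℝ → ℝ} (hf : ExpDecay f) {B : ℝ} (hg : ∀ t, |g t| ≤ B) :
    ExpDecay fun t => f t * g t := by
  obtain ⟨C, hC, h⟩ := hf
  have hB : 0 ≤ B := (abs_nonneg _).trans (hg 0)
  refine ⟨C * B, by positivity, fun t => ?_⟩
  rw [abs_mul]
  calc _ ≤ (C * Real.exp (-|t|)) * B :=
        mul_le_mul (h t) (hg t) (abs_nonneg _) (by positivity)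
    _ = _ := by ring

lemma abs_sech_le_one (t : ℝ) : |sech t| ≤ 1 := by
  rw [abs_of_pos (sech_pos t)]; exact sech_le_one t

lemma abs_tanh_le_one (t : ℝ) : |Real.tanh t| ≤ 1 := by
  rw [Real.tanh_eq_sinh_div_cosh, abs_div, abs_of_pos (Real.cosh_pos t),
    div_le_one (Real.cosh_pos t), abs_le]
  have h1 := Real.exp_pos t
  have h2 := Real.exp_pos (-t)
  rw [Real.cosh_eq, Real.sinh_eq]
  constructor <;> linarith

lemma expDecay_sech_sq : ExpDecay fun t => sech t ^ 2 := by
  simpa only [sq] using expDecay_sech.mul_bounded abs_sech_le_one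

lemma expDecay_sech_cube : ExpDecay fun t => sech t ^ 3 := by
  simpa only [pow_succ, pow_zero, one_mul] using expDecay_sech_sq.mul_bounded abs_sech_le_one

lemma expDecay_sech_mul_tanh : ExpDecay fun t => sech t * Real.tanh t :=
  expDecay_sech.mul_bounded abs_tanh_le_one

lemma summable_int_mul_exp {c : ℝ} (hc : 0 < c) :
    Summable fun n : ℤ => (1 + |(n:ℝ)|) * Real.exp (-(|(n:ℝ)| * c)) := by
  have key : Summable fun n : ℕ => (1 + (n:ℝ)) * Real.exp (-((n:ℝ) * c)) := by
    have h1 := Real.summable_pow_mul_exp_neg_nat_mul 0 hc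
    have h2 := Real.summable_pow_mul_exp_neg_nat_mul 1 hc
    refine (h1.add h2).congr fun n => ?_
    rw [show -((n:ℝ) * c) = -c * n by ring]; ring
  refine Summable.of_nat_of_neg ?_ ?_
  · simpa using key
  · simpa using key

lemma summable_int_exp {c : ℝ} (hc : 0 < c) :
    Summable fun n : ℤ => Real.exp (-(|(n:ℝ)| * c)) := by
  refine Summable.of_nonneg_of_le (fun _ => (Real.exp_pos _).le) (fun n => ?_)
    (summable_int_mul_exp hc)
  exact le_mul_of_one_le_left (Real.exp_pos _).le (by linarith [abs_nonneg (n:ℝ)])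

/-- The sum of `f` over the shifted lattice `w + ℤ P`. -/
noncomputable def latticeSum (f : ℝ → ℝ) (P w : ℝ) : ℝ := ∑' n : ℤ, f (w + n * P)

lemma ExpDecay.summable {f : ℝ → ℝ} (hf : ExpDecay f) {P : ℝ} (hP : 0 < P) (w : ℝ) :
    Summable fun n : ℤ => f (w + n * P) := by
  obtain ⟨C, hC, h⟩ := hf
  refine Summable.of_norm_bounded ((summable_int_exp hP).mul_left (C * Real.exp |w|)) fun n => ?_
  rw [Real.norm_eq_abs]
  refine (h _).trans ?_
  rw [mul_assoc, ← Real.exp_add]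
  gcongr
  have : |(n:ℝ) * P| ≤ |w + n * P| + |w| := by
    calc |(n:ℝ) * P| = |(w + n * P) - w| := by ring_nf
      _ ≤ _ := abs_sub _ _
  rw [abs_mul, abs_of_pos hP] at this
  linarith

lemma latticeSum_add_period (f : ℝ → ℝ) (P w : ℝ) : latticeSum f P (w + P) = latticeSum f P w := by
  rw [latticeSum, latticeSum, ← (Equiv.addRight (1:ℤ)).tsum_eq fun n : ℤ => f (w + n * P)]
  refine tsum_congr fun n => ?_
  simp only [Equiv.coe_addRight]
  push_cast; ring_nf

lemma latticeSum_neg {f : ℝ → ℝ} (hf : ∀ t, f (-t) = f t) (P w : ℝ) :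
    latticeSum f P (-w) = latticeSum f P w := by
  rw [latticeSum, latticeSum, ← (Equiv.neg ℤ).tsum_eq fun n : ℤ => f (w + n * P)]
  refine tsum_congr fun n => ?_
  rw [← hf]; simp only [Equiv.neg_apply]
  push_cast; ring_nf

lemma tsum_int_even_add_odd {g : ℤ → ℝ} (hg : Summable g) :
    ∑' n : ℤ, g n = ∑' n : ℤ, g (2 * n) + ∑' n : ℤ, g (2 * n + 1) := by
  have h2 : Summable fun p : ℤ × Fin 2 => g ((Int.divModEquiv 2).symm p) :=
    (Equiv.summable_iff _).mpr hg
  have he : Summable fun n : ℤ => g (2 * n) :=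
    hg.comp_injective fun a b h => by simpa using h
  have ho : Summable fun n : ℤ => g (2 * n + 1) :=
    hg.comp_injective fun a b h => by simpa using h
  rw [← (Int.divModEquiv 2).symm.tsum_eq g, h2.tsum_prod, ← he.tsum_add ho]
  refine tsum_congr fun n => ?_
  rw [tsum_fintype, Fin.sum_univ_two]
  simp [Int.divModEquiv, mul_comm]

lemma ExpDecay.latticeSum_split {f : ℝ → ℝ} (hf : ExpDecay f) {P : ℝ} (hP : 0 < P) (w : ℝ) :
    latticeSum f P w = latticeSum f (2 * P) w + latticeSum f (2 * P) (w + P) := by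
  rw [latticeSum, tsum_int_even_add_odd (hf.summable hP w), latticeSum, latticeSum]
  congr 1 <;> refine tsum_congr fun n => ?_ <;> push_cast <;> ring_nf

lemma sech_mul_sech (b δ : ℝ) (hδ : δ ≠ 0) :
    sech b * sech (b + δ) = (Real.tanh (b + δ) - Real.tanh b) / Real.sinh δ := by
  have h1 := (Real.cosh_pos b).ne'
  have h2 := (Real.cosh_pos (b + δ)).ne'
  have h3 : Real.sinh δ ≠ 0 := by simpa using hδ
  have h4 : Real.sinh δ
      = Real.sinh (b + δ) * Real.cosh b - Real.cosh (b + δ) * Real.sinh b := by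
    rw [← Real.sinh_sub]; ring_nf
  rw [Real.tanh_eq_sinh_div_cosh, Real.tanh_eq_sinh_div_cosh, sech, sech]
  field_simp
  linarith

lemma sech_sq_mul_sech (b δ : ℝ) (hδ : δ ≠ 0) :
    sech b ^ 2 * sech (b + δ) = (Real.cosh δ * sech b - sech (b + δ)) / Real.sinh δ ^ 2
      - sech b * Real.tanh b / Real.sinh δ := by
  have h1 := (Real.cosh_pos b).ne'
  have h2 := (Real.cosh_pos (b + δ)).ne'
  have h3 : Real.sinh δ ≠ 0 := by simpa using hδ
  rw [Real.tanh_eq_sinh_div_cosh, sech, sech]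
  field_simp
  rw [Real.cosh_add]
  have := Real.cosh_sq b
  have := Real.cosh_sq δ
  grind

lemma tendsto_tanh_atTop : Tendsto Real.tanh atTop (𝓝 1) := by
  have h : Tendsto (fun t : ℝ => Real.exp (-(2 * t))) atTop (𝓝 0) :=
    Real.tendsto_exp_neg_atTop_nhds_zero.comp (tendsto_id.const_mul_atTop (by norm_num : (0:ℝ) < 2))
  have h2 : Tendsto (fun t : ℝ => (1 - Real.exp (-(2 * t))) / (1 + Real.exp (-(2 * t)))) atTop
      (𝓝 ((1 - 0) / (1 + 0))) :=
    (tendsto_const_nhds.sub h).div (tendsto_const_nhds.add h) (by norm_num)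
  simp only [sub_zero, add_zero, div_one] at h2
  refine h2.congr fun t => ?_
  rw [Real.tanh_eq_sinh_div_cosh, Real.sinh_eq, Real.cosh_eq,
    show -(2 * t) = -t + -t by ring, Real.exp_add]
  have := Real.exp_pos t
  have h3 : Real.exp (-t) * Real.exp t = 1 := by rw [← Real.exp_add]; simp
  have h4 := Real.exp_pos (-t)
  rw [div_div_div_cancel_right₀ (by norm_num), div_eq_div_iff (by positivity) (by positivity)]
  ring_nf
  have h5 : Real.exp t * Real.exp (-t) ^ 2 = Real.exp (-t) := by
    rw [sq, ← mul_assoc, mul_comm (Real.exp t), h3, one_mul]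
  linarith

lemma HasSum.of_forall_eq {ι : Type*} {f g : ι → ℝ} {a : ℝ} (hg : HasSum g a)
    (h : ∀ i, f i = g i) : HasSum f a := by
  rwa [funext h]

lemma hasSum_tanh_step {P : ℝ} (hP : 0 < P) (w : ℝ) :
    HasSum (fun n : ℤ => Real.tanh (w + n * P + P) - Real.tanh (w + n * P)) 2 := by
  have hpos (w : ℝ) : HasSum (fun n : ℕ => Real.tanh (w + n * P + P) - Real.tanh (w + n * P))
      (1 - Real.tanh w) := by
    have hnn (n : ℕ) : 0 ≤ Real.tanh (w + n * P + P) - Real.tanh (w + n * P) := by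
      have h := sech_mul_sech (w + n * P) P hP.ne'
      have h2 : 0 < Real.sinh P := Real.sinh_pos_iff.mpr hP
      rw [eq_div_iff h2.ne'] at h
      rw [← h]
      have := sech_pos (w + n * P)
      have := sech_pos (w + n * P + P)
      positivity
    rw [hasSum_iff_tendsto_nat_of_nonneg hnn]
    have hs (N : ℕ) : ∑ i ∈ Finset.range N, (Real.tanh (w + i * P + P) - Real.tanh (w + i * P))
        = Real.tanh (w + N * P) - Real.tanh w := by
      have := Finset.sum_range_sub (fun n : ℕ => Real.tanh (w + n * P)) N
      simp only [Nat.cast_zero, zero_mul, add_zero] at this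
      rw [← this]
      refine Finset.sum_congr rfl fun i _ => ?_
      push_cast; ring_nf
    simp only [hs]
    refine Tendsto.sub_const (tendsto_tanh_atTop.comp ?_) _
    exact tendsto_atTop_add_const_left _ _ (tendsto_natCast_atTop_atTop.atTop_mul_const hP)
  have h := HasSum.of_nat_of_neg_add_one
    (f := fun n : ℤ => Real.tanh (w + n * P + P) - Real.tanh (w + n * P))
    (m := 1 - Real.tanh w) (m' := 1 - Real.tanh (-w)) (by simpa using hpos w) (by
      have e : (fun n : ℕ => Real.tanh (w + (-((n:ℤ) + 1) : ℤ) * P + P)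
          - Real.tanh (w + (-((n:ℤ) + 1) : ℤ) * P))
          = fun n : ℕ => Real.tanh (-w + n * P + P) - Real.tanh (-w + n * P) := by
        funext n
        rw [← neg_sub_neg, ← Real.tanh_neg, ← Real.tanh_neg]
        push_cast; ring_nf
      simpa only [e] using hpos (-w))
  rw [Real.tanh_neg] at h
  convert h using 1
  ring

lemma hasSum_tanh_shift {P : ℝ} (hP : 0 < P) (r : ℤ) : ∀ w : ℝ,
    HasSum (fun n : ℤ => Real.tanh (w + n * P + r * P) - Real.tanh (w + n * P)) (2 * r) := by
  induction r using Int.induction_on with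
  | zero => intro w; simp
  | succ r ih =>
    intro w
    have h := (ih (w + P)).add (hasSum_tanh_step hP w)
    have e : (2:ℝ) * ((r + 1 : ℤ) : ℝ) = 2 * ((r:ℤ):ℝ) + 2 := by push_cast; ring
    rw [e]
    refine h.of_forall_eq fun n => ?_
    push_cast; ring_nf
  | pred r ih =>
    intro w
    have h := (ih (w - P)).sub (hasSum_tanh_step hP (w - P))
    have e : (2:ℝ) * ((-r - 1 : ℤ) : ℝ) = 2 * ((-r:ℤ):ℝ) - 2 := by push_cast; ring
    rw [e]
    refine h.of_forall_eq fun n => ?_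
    push_cast; ring_nf

/-- The map `(r, n) ↦ (n, n + r)` used to sum over differences. -/
def shearEquiv : ℤ × ℤ ≃ ℤ × ℤ where
  toFun p := (p.2, p.2 + p.1)
  invFun p := (p.2 - p.1, p.1)
  left_inv p := by ext <;> simp
  right_inv p := by ext <;> simp

lemma latticeSum_mul_latticeSum {f g : ℝ → ℝ} (hf : ExpDecay f) (hg : ExpDecay g) {P : ℝ}
    (hP : 0 < P) (w : ℝ) :
    HasSum (fun r : ℤ => ∑' n : ℤ, f (w + n * P) * g (w + n * P + r * P))
      (latticeSum f P w * latticeSum g P w) := by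
  have hsf := (hf.summable hP w).norm
  have hsg := (hg.summable hP w).norm
  have hs := summable_mul_of_summable_norm hsf hsg
  have h1 : HasSum (fun p : ℤ × ℤ => f (w + p.1 * P) * g (w + p.2 * P))
      (latticeSum f P w * latticeSum g P w) := by
    rw [latticeSum, latticeSum, tsum_mul_tsum_of_summable_norm hsf hsg]
    exact hs.hasSum
  have h2 := shearEquiv.hasSum_iff.mpr h1
  have h3 := h2.prod_fiberwise (fun r => (h2.summable.prod_factor r).hasSum)
  refine h3.of_forall_eq fun r => tsum_congr fun n => ?_
  simp only [Function.comp, shearEquiv, Equiv.coe_fn_mk]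
  push_cast; ring_nf

/-- `(∑ sech)² - ∑ sech²` does not depend on the shift. -/
lemma latticeSum_sech_sq {P : ℝ} (hP : 0 < P) :
    ∃ κ : ℝ, ∀ w, latticeSum sech P w ^ 2 = latticeSum (fun t => sech t ^ 2) P w + κ := by
  refine ⟨∑' r : ℤ, if r = 0 then 0 else 2 * (r:ℝ) / Real.sinh (r * P), fun w => ?_⟩
  have h := latticeSum_mul_latticeSum expDecay_sech expDecay_sech hP w
  rw [sq, ← h.tsum_eq, h.summable.tsum_eq_add_tsum_ite 0]
  congr 1
  · simp [latticeSum, sq]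
  · refine tsum_congr fun r => ?_
    split_ifs with hr
    · rfl
    · have hδ : (r:ℝ) * P ≠ 0 := mul_ne_zero (by exact_mod_cast hr) hP.ne'
      simp only [sech_mul_sech _ _ hδ]
      exact ((hasSum_tanh_shift hP r w).div_const _).tsum_eq

lemma latticeSum_sech_sq_mul {P : ℝ} (hP : 0 < P) :
    ∃ κ : ℝ, ∀ w, latticeSum (fun t => sech t ^ 2) P w * latticeSum sech P w
      = latticeSum (fun t => sech t ^ 3) P w + κ * latticeSum sech P w := by
  refine ⟨∑' r : ℤ, if r = 0 then 0 else (Real.cosh (r * P) - 1) / Real.sinh (r * P) ^ 2,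
    fun w => ?_⟩
  have h := latticeSum_mul_latticeSum expDecay_sech_sq expDecay_sech hP w
  have hn := (Equiv.neg ℤ).hasSum_iff.mpr h
  have hsym := (h.add hn).div_const 2
  rw [show (latticeSum (fun t => sech t ^ 2) P w * latticeSum sech P w +
    latticeSum (fun t => sech t ^ 2) P w * latticeSum sech P w) / 2 =
    latticeSum (fun t => sech t ^ 2) P w * latticeSum sech P w by ring] at hsym
  rw [← hsym.tsum_eq, hsym.summable.tsum_eq_add_tsum_ite 0, ← tsum_mul_right]
  congr 1
  · have : ∀ t : ℝ, sech t ^ 3 = sech t ^ 2 * sech t := fun t => by ring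
    simp [latticeSum, this]
  · refine tsum_congr fun r => ?_
    split_ifs with hr
    · simp
    · have key (r : ℤ) (hr : r ≠ 0) : ∑' n : ℤ, sech (w + n * P) ^ 2 * sech (w + n * P + r * P)
          = (Real.cosh (r * P) * latticeSum sech P w - latticeSum sech P w)
              / Real.sinh (r * P) ^ 2
            - latticeSum (fun t => sech t * Real.tanh t) P w / Real.sinh (r * P) := by
        have hδ : (r:ℝ) * P ≠ 0 := mul_ne_zero (by exact_mod_cast hr) hP.ne'
        simp only [sech_sq_mul_sech _ _ hδ]
        have h1 := (expDecay_sech.summable hP w).hasSum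
        have h2 : HasSum (fun n : ℤ => sech (w + n * P + r * P)) (latticeSum sech P w) := by
          have := (Equiv.addRight r).hasSum_iff.mpr h1
          refine this.of_forall_eq fun n => ?_
          simp only [Function.comp, Equiv.coe_addRight]
          push_cast; ring_nf
        have h3 := (expDecay_sech_mul_tanh.summable hP w).hasSum
        exact ((((h1.mul_left (Real.cosh (r * P))).sub h2).div_const _).sub
          (h3.div_const _)).tsum_eq
      simp only [Function.comp, Equiv.neg_apply]
      rw [key r hr, key (-r) (neg_ne_zero.mpr hr)]
      push_cast
      rw [neg_mul, Real.cosh_neg, Real.sinh_neg]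
      ring

lemma latticeSum_sech_cube {P : ℝ} (hP : 0 < P) :
    ∃ κ : ℝ, ∀ w, latticeSum (fun t => sech t ^ 3) P w
      = latticeSum sech P w ^ 3 - κ * latticeSum sech P w := by
  obtain ⟨κ₁, h₁⟩ := latticeSum_sech_sq hP
  obtain ⟨κ₂, h₂⟩ := latticeSum_sech_sq_mul hP
  refine ⟨κ₁ + κ₂, fun w => ?_⟩
  have a := h₁ w
  have b := h₂ w
  rw [show latticeSum (fun t => sech t ^ 2) P w = latticeSum sech P w ^ 2 - κ₁ by linarith] at b
  linear_combination -b

lemma latticeSum_mul_half_period {P : ℝ} (hP : 0 < P) (w : ℝ) :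
    latticeSum sech (2 * P) w * latticeSum sech (2 * P) (w + P)
      = latticeSum sech (2 * P) 0 * latticeSum sech (2 * P) P := by
  obtain ⟨κ, h⟩ := latticeSum_sech_sq hP
  obtain ⟨κ', h'⟩ := latticeSum_sech_sq (P := 2 * P) (by positivity)
  have key (w : ℝ) : 2 * (latticeSum sech (2 * P) w * latticeSum sech (2 * P) (w + P))
      = κ - 2 * κ' := by
    have := h w
    rw [expDecay_sech.latticeSum_split hP, expDecay_sech_sq.latticeSum_split hP] at this
    linear_combination this - h' w - h' (w + P)
  have h1 := key w
  have h2 := key 0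
  rw [zero_add] at h2
  linarith

/-- `D(P) = ∑ sech (nP)`. -/
noncomputable def sechSum (P : ℝ) : ℝ := latticeSum sech P 0

/-- `O(P) = ∑ sech ((2n+1)P)`. -/
noncomputable def sechOddSum (P : ℝ) : ℝ := latticeSum sech (2 * P) P

/-- `E(P) = ∑ (-1)^n sech (nP)`. -/
noncomputable def sechAltSum (P : ℝ) : ℝ := sechSum (2 * P) - sechOddSum P

lemma sechSum_eq_add {P : ℝ} (hP : 0 < P) : sechSum P = sechSum (2 * P) + sechOddSum P := by
  have := expDecay_sech.latticeSum_split hP 0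
  rwa [zero_add] at this

lemma latticeSum_sech_pos {P : ℝ} (hP : 0 < P) (w : ℝ) : 0 < latticeSum sech P w :=
  (expDecay_sech.summable hP w).tsum_pos (fun _ => (sech_pos _).le) 0 (sech_pos _)

lemma sechSum_pos {P : ℝ} (hP : 0 < P) : 0 < sechSum P := latticeSum_sech_pos hP 0

lemma sechOddSum_pos {P : ℝ} (hP : 0 < P) : 0 < sechOddSum P :=
  latticeSum_sech_pos (by positivity) P

lemma sechOddSum_sq {P : ℝ} (hP : 0 < P) :
    sechOddSum P ^ 2 = sechSum (2 * P) ^ 2 - sechAltSum (2 * P) ^ 2 := by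
  have h2 : 0 < 2 * P := by positivity
  have h1 : sechOddSum P = 2 * latticeSum sech (2 * (2 * P)) P := by
    rw [sechOddSum, expDecay_sech.latticeSum_split h2]
    have : latticeSum sech (2 * (2 * P)) (P + 2 * P) = latticeSum sech (2 * (2 * P)) P := by
      rw [← latticeSum_neg sech_neg, ← latticeSum_add_period]
      ring_nf
    rw [this]; ring
  have h3 := latticeSum_mul_half_period h2 (-P)
  rw [latticeSum_neg sech_neg, show -P + 2 * P = P by ring] at h3
  rw [sechSum_eq_add h2, sechAltSum, h1, sechSum, sechOddSum]
  linear_combination 4 * h3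

lemma sechAltSum_sq {P : ℝ} (hP : 0 < P) :
    sechAltSum (2 * P) ^ 2 = sechSum P * sechAltSum P := by
  have := sechOddSum_sq hP
  rw [sechSum_eq_add hP, sechAltSum.eq_1 P]
  linarith

lemma eq_of_tendsto_of_double {g : ℝ → ℝ} {L : ℝ} (h : ∀ P, 0 < P → g (2 * P) = g P)
    (hL : Tendsto g atTop (𝓝 L)) {P : ℝ} (hP : 0 < P) : g P = L := by
  have h1 (n : ℕ) : g (2 ^ n * P) = g P := by
    induction n with
    | zero => simp
    | succ n ih => rw [pow_succ', mul_assoc, h _ (by positivity), ih]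
  have h2 : Tendsto (fun n : ℕ => (2:ℝ) ^ n * P) atTop atTop :=
    (tendsto_pow_atTop_atTop_of_one_lt (by norm_num)).atTop_mul_const hP
  exact tendsto_nhds_unique (tendsto_const_nhds.congr fun n => (h1 n).symm) (hL.comp h2)

/-- Leading asymptotics of `∑ wₙ f(cₙ P)` when the smallest `|cₙ|` is `k`. -/
lemma ExpDecay.tendsto_exp_mul_tsum {f : ℝ → ℝ} (hf : ExpDecay f) {c w L : ℤ → ℝ} {k A : ℝ}
    (hck : ∀ n, k ≤ |c n|) (hcn : ∀ n : ℤ, |(n:ℝ)| - 1 ≤ |c n| - k)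
    (hw : ∀ n : ℤ, |w n| ≤ A * (1 + |(n:ℝ)|))
    (hL : ∀ n, |c n| = k →
      Tendsto (fun P => Real.exp (k * P) * (w n * f (c n * P))) atTop (𝓝 (L n)))
    (hL0 : ∀ n, |c n| ≠ k → L n = 0) :
    Tendsto (fun P => Real.exp (k * P) * ∑' n : ℤ, w n * f (c n * P)) atTop (𝓝 (∑' n, L n)) := by
  obtain ⟨C, hC, h⟩ := hf
  have hA : 0 ≤ A := by simpa using (abs_nonneg _).trans (hw 0)
  simp only [← tsum_mul_left]
  have hterm (n : ℤ) (P : ℝ) (hP : 0 < P) : |Real.exp (k * P) * (w n * f (c n * P))|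
      ≤ A * (1 + |(n:ℝ)|) * C * Real.exp (-((|c n| - k) * P)) := by
    rw [abs_mul, abs_mul, abs_of_pos (Real.exp_pos _)]
    have h1 := h (c n * P)
    rw [abs_mul, abs_of_pos hP] at h1
    calc _ ≤ Real.exp (k * P) * ((A * (1 + |(n:ℝ)|)) * (C * Real.exp (-(|c n| * P)))) := by
          gcongr
          exact hw n
      _ = A * (1 + |(n:ℝ)|) * C * (Real.exp (k * P) * Real.exp (-(|c n| * P))) := by ring
      _ = _ := by rw [← Real.exp_add]; ring_nf
  refine tendsto_tsum_of_dominated_convergence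
    (bound := fun n : ℤ => A * C * Real.exp 1 * ((1 + |(n:ℝ)|) * Real.exp (-(|(n:ℝ)| * 1))))
    ((summable_int_mul_exp one_pos).mul_left _) (fun n => ?_) ?_
  · by_cases hn : |c n| = k
    · exact hL n hn
    · rw [hL0 n hn]
      have hpos : 0 < |c n| - k := sub_pos.mpr (lt_of_le_of_ne (hck n) (Ne.symm hn))
      have h0 : Tendsto (fun P : ℝ => A * (1 + |(n:ℝ)|) * C * Real.exp (-((|c n| - k) * P))) atTop
          (𝓝 (A * (1 + |(n:ℝ)|) * C * 0)) :=
        (Real.tendsto_exp_neg_atTop_nhds_zero.comp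
          (tendsto_id.const_mul_atTop hpos)).const_mul _
      rw [mul_zero] at h0
      refine squeeze_zero_norm' ?_ h0
      filter_upwards [eventually_gt_atTop 0] with P hP
      exact hterm n P hP
  · filter_upwards [eventually_ge_atTop 1] with P hP n
    rw [Real.norm_eq_abs]
    refine (hterm n P (by linarith)).trans ?_
    calc _ ≤ A * (1 + |(n:ℝ)|) * C * Real.exp (1 + -(|(n:ℝ)| * 1)) := by
          gcongr
          have := hcn n
          have := hck n
          nlinarith
      _ = _ := by rw [Real.exp_add]; ring

lemma ExpDecay.tendsto_latticeSum {f : ℝ → ℝ} (hf : ExpDecay f) :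
    Tendsto (fun P => latticeSum f P 0) atTop (𝓝 (f 0)) := by
  have h := hf.tendsto_exp_mul_tsum (c := fun n => n) (w := fun _ => 1)
    (L := fun n => if n = 0 then f 0 else 0) (k := 0) (A := 1) (fun n => abs_nonneg _)
    (fun n => by linarith) (fun n => by simp) (fun n hn => ?_) (fun n hn => ?_)
  · simpa [latticeSum] using h
  · have : n = 0 := by simpa using hn
    simp [this]
  · have : n ≠ 0 := by simpa using hn
    simp [this]

lemma tendsto_sechSum : Tendsto sechSum atTop (𝓝 1) := by
  have := expDecay_sech.tendsto_latticeSum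
  rwa [sech_zero] at this

lemma tendsto_two_mul_atTop : Tendsto (fun P : ℝ => 2 * P) atTop atTop :=
  tendsto_id.const_mul_atTop (by norm_num)

lemma tendsto_sechAltSum : Tendsto sechAltSum atTop (𝓝 1) := by
  have h : Tendsto (fun P => 2 * sechSum (2 * P) - sechSum P) atTop (𝓝 (2 * 1 - 1)) :=
    ((tendsto_sechSum.comp tendsto_two_mul_atTop).const_mul 2).sub tendsto_sechSum
  norm_num at h
  refine h.congr' ?_
  filter_upwards [eventually_gt_atTop 0] with P hP
  rw [sechSum_eq_add hP, sechAltSum]; ring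

lemma pos_of_double {g : ℝ → ℝ} (h : ∀ P, 0 < P → 0 < g (2 * P) → 0 < g P)
    (hL : ∀ᶠ P in atTop, 0 < g P) {P : ℝ} (hP : 0 < P) : 0 < g P := by
  have h2 : Tendsto (fun n : ℕ => (2:ℝ) ^ n * P) atTop atTop :=
    (tendsto_pow_atTop_atTop_of_one_lt (by norm_num)).atTop_mul_const hP
  obtain ⟨n, hn⟩ := (h2.eventually hL).exists
  induction n with
  | zero => simpa using hn
  | succ n ih => exact ih (h _ (by positivity) (by rwa [pow_succ', mul_assoc] at hn))

lemma sechAltSum_pos {P : ℝ} (hP : 0 < P) : 0 < sechAltSum P := by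
  refine pos_of_double (fun P hP h => ?_) (tendsto_sechAltSum.eventually (lt_mem_nhds one_pos)) hP
  have h1 := sechAltSum_sq hP
  have h2 : 0 < sechSum P * sechAltSum P := by rw [← h1]; positivity
  exact (pos_iff_pos_of_mul_pos h2).mp (sechSum_pos hP)

lemma sechAltSum_lt {P : ℝ} (hP : 0 < P) : sechAltSum P < sechSum P := by
  rw [sechSum_eq_add hP, sechAltSum]; linarith [sechOddSum_pos hP]

/-- The ratio `E / D`. -/
noncomputable def sechRatio (P : ℝ) : ℝ := sechAltSum P / sechSum P

lemma sechRatio_pos {P : ℝ} (hP : 0 < P) : 0 < sechRatio P :=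
  div_pos (sechAltSum_pos hP) (sechSum_pos hP)

lemma sechRatio_lt_one {P : ℝ} (hP : 0 < P) : sechRatio P < 1 :=
  (div_lt_one (sechSum_pos hP)).mpr (sechAltSum_lt hP)

lemma tendsto_sechRatio : Tendsto sechRatio atTop (𝓝 1) := by
  have h := tendsto_sechAltSum.div tendsto_sechSum one_ne_zero
  rw [div_one] at h
  exact h

lemma continuousOn_hyp2F1half : ContinuousOn hyp2F1half (Set.Ioo (-1) 1) := by
  intro z hz
  obtain ⟨r, hr, hr1⟩ := exists_between (abs_lt.mpr hz)
  have hr0 : 0 ≤ r := (abs_nonneg z).trans hr.le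
  have h : ContinuousOn hyp2F1half (Set.Icc (-r) r) := by
    refine continuousOn_tsum (u := fun n => r ^ n) (fun n => by fun_prop)
      (summable_geometric_of_lt_one hr0 hr1) fun n x hx => ?_
    rw [← invSqrtCoeff, norm_mul, norm_pow, norm_pow, Real.norm_of_nonneg (invSqrtCoeff_nonneg n),
      Real.norm_eq_abs]
    calc _ ≤ 1 * r ^ n := by
          gcongr
          · exact pow_le_one₀ (invSqrtCoeff_nonneg n) (invSqrtCoeff_le_one n)
          · exact abs_le.mpr hx
      _ = _ := one_mul _
  exact (h.continuousAt (Icc_mem_nhds (abs_lt.mp hr).1 (abs_lt.mp hr).2)).continuousWithinAt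

lemma hyp2F1half_zero : hyp2F1half 0 = 1 := by
  rw [hyp2F1half, tsum_eq_single 0 (fun n hn => by simp [hn])]
  simp [poch]

/-- Gauss: the hypergeometric function at `1 - (E/D)²` is `D`. -/
lemma hyp2F1half_sechRatio {P : ℝ} (hP : 0 < P) :
    hyp2F1half (1 - sechRatio P ^ 2) = sechSum P := by
  have h := eq_of_tendsto_of_double
    (g := fun P => hyp2F1half (1 - sechRatio P ^ 2) / sechSum P) (L := 1) (fun P hP => ?_) ?_ hP
  · rwa [div_eq_one_iff_eq (sechSum_pos hP).ne'] at h
  · rw [hyp2F1half_landen (sechRatio_pos hP) (sechRatio_lt_one hP).le]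
    have hD := sechSum_pos hP
    have hE := sechAltSum_pos hP
    have hD2 : sechSum (2 * P) = (sechSum P + sechAltSum P) / 2 := by
      rw [sechSum_eq_add hP, sechAltSum]; ring
    have e : 1 - sechRatio (2 * P) ^ 2 = ((1 - sechRatio P) / (1 + sechRatio P)) ^ 2 := by
      rw [sechRatio, sechRatio, div_pow, sechAltSum_sq hP, hD2]
      field_simp
      ring
    rw [e, hD2, sechRatio]
    field_simp
  · have h1 : Tendsto (fun P => 1 - sechRatio P ^ 2) atTop (𝓝 0) := by
      simpa using (tendsto_sechRatio.pow 2).const_sub 1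
    have h2 : ContinuousAt hyp2F1half 0 :=
      continuousOn_hyp2F1half.continuousAt (Ioo_mem_nhds (by norm_num) (by norm_num))
    have h3 := (h2.tendsto.comp h1).div tendsto_sechSum one_ne_zero
    rw [hyp2F1half_zero, div_one] at h3
    exact h3

lemma latticeSum_sech_cube_eq {P : ℝ} (hP : 0 < P) (w : ℝ) :
    2 * latticeSum (fun t => sech t ^ 3) P w = 2 * latticeSum sech P w ^ 3
      + (1 - 2 * sechSum P ^ 2 + sechAltSum P ^ 2) * latticeSum sech P w := by
  set T : ℝ → ℝ := fun P => latticeSum (fun t => sech t ^ 3) P 0 with hT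
  set g : ℝ → ℝ := fun P => 2 * ((sechSum P ^ 3 - T P) / sechSum P)
    - 2 * sechSum P ^ 2 + sechAltSum P ^ 2 with hg
  have hκ {P : ℝ} (hP : 0 < P) {κ : ℝ} (h : ∀ w, latticeSum (fun t => sech t ^ 3) P w
      = latticeSum sech P w ^ 3 - κ * latticeSum sech P w) :
      g P = 2 * κ - 2 * sechSum P ^ 2 + sechAltSum P ^ 2 := by
    have h0 := h 0
    have hD := (sechSum_pos hP).ne'
    simp only [hg, hT]
    rw [h0, ← sechSum]
    field_simp
    ring
  have hlim : Tendsto g atTop (𝓝 (2 * ((1 ^ 3 - 1) / 1) - 2 * 1 ^ 2 + 1 ^ 2)) := by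
    have hTl : Tendsto T atTop (𝓝 1) := by
      have := expDecay_sech_cube.tendsto_latticeSum
      rwa [sech_zero, one_pow] at this
    exact (((((tendsto_sechSum.pow 3).sub hTl).div tendsto_sechSum one_ne_zero).const_mul 2).sub
      ((tendsto_sechSum.pow 2).const_mul 2)).add (tendsto_sechAltSum.pow 2)
  have hdouble (P : ℝ) (hP : 0 < P) : g (2 * P) = g P := by
    obtain ⟨κ, h⟩ := latticeSum_sech_cube hP
    have h2P : 0 < 2 * P := by positivity
    obtain ⟨κ', h'⟩ := latticeSum_sech_cube h2P
    rw [hκ hP h, hκ h2P h', ← sub_eq_zero, sechAltSum_sq hP]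
    have e := h 0
    rw [expDecay_sech_cube.latticeSum_split hP, expDecay_sech.latticeSum_split hP, h' 0, h' _,
      zero_add] at e
    rw [← sechSum, ← sechOddSum] at e
    have hD := sechSum_pos hP
    rw [sechSum_eq_add hP] at hD ⊢
    rw [sechAltSum]
    set V := sechSum (2 * P)
    set O := sechOddSum P
    have e2 : (V + O) * (κ - κ' - 3 * V * O) = 0 := by linear_combination e
    have e3 := (mul_eq_zero.mp e2).resolve_left hD.ne'
    linear_combination (-2) * e3
  obtain ⟨κ, h⟩ := latticeSum_sech_cube hP
  have h1 := eq_of_tendsto_of_double hdouble hlim hP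
  rw [hκ hP h] at h1
  rw [h w]
  linear_combination (-latticeSum sech P w) * h1

lemma ExpDecay.neg {f : ℝ → ℝ} (hf : ExpDecay f) : ExpDecay fun t => -f t := by
  obtain ⟨C, hC, h⟩ := hf
  exact ⟨C, hC, fun t => by rw [abs_neg]; exact h t⟩

/-- Termwise differentiation of `∑ wₙ f(cₙ P)`. -/
lemma ExpDecay.hasDerivAt_tsum {f f' : ℝ → ℝ} (hf : ExpDecay f) (hf' : ExpDecay f')
    (hd : ∀ t, HasDerivAt f (f' t) t) {c w : ℤ → ℝ} {A : ℝ} (hc : ∀ n : ℤ, |(n:ℝ)| ≤ |c n|)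
    (hw : ∀ n : ℤ, |w n| ≤ A * (1 + |(n:ℝ)|)) (hwc : ∀ n : ℤ, |w n * c n| ≤ A * (1 + |(n:ℝ)|))
    {P : ℝ} (hP : 0 < P) :
    HasDerivAt (fun P => ∑' n : ℤ, w n * f (c n * P))
      (∑' n : ℤ, (w n * c n) * f' (c n * P)) P := by
  obtain ⟨C, hC, h⟩ := hf
  obtain ⟨C', hC', h'⟩ := hf'
  have hA : 0 ≤ A := by simpa using (abs_nonneg _).trans (hw 0)
  have hb {C : ℝ} (hC : 0 ≤ C) {f : ℝ → ℝ} (h : ∀ t, |f t| ≤ C * Real.exp (-|t|)) {v : ℤ → ℝ}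
      (hv : ∀ n : ℤ, |v n| ≤ A * (1 + |(n:ℝ)|)) (n : ℤ) {y : ℝ} (hy : P / 2 < y) :
      ‖v n * f (c n * y)‖ ≤ A * C * ((1 + |(n:ℝ)|) * Real.exp (-(|(n:ℝ)| * (P / 2)))) := by
    rw [Real.norm_eq_abs, abs_mul]
    have h1 := h (c n * y)
    have hy0 : 0 < y := by linarith
    rw [abs_mul, abs_of_pos hy0] at h1
    have h2 : |(n:ℝ)| * (P / 2) ≤ |c n| * y :=
      mul_le_mul (hc n) hy.le (by positivity) (abs_nonneg _)
    calc _ ≤ (A * (1 + |(n:ℝ)|)) * (C * Real.exp (-(|(n:ℝ)| * (P / 2)))) := by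
          refine mul_le_mul (hv n) (h1.trans ?_) (abs_nonneg _) (by positivity)
          gcongr
      _ = _ := by ring
  have hs := summable_int_mul_exp (half_pos hP)
  have hPm : P ∈ Set.Ioi (P / 2) := by simp only [Set.mem_Ioi]; linarith
  refine hasDerivAt_tsum_of_isPreconnected (g := fun n P => w n * f (c n * P))
    (g' := fun n P => (w n * c n) * f' (c n * P)) (hs.mul_left (A * C')) isOpen_Ioi
    isPreconnected_Ioi (fun n y _ => ?_) (fun n y hy => hb hC' h' hwc n hy) hPm
    (Summable.of_norm_bounded (hs.mul_left (A * C)) fun n => hb hC h hw n hPm) hPm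
  have := ((hd (c n * y)).comp y ((hasDerivAt_id y).const_mul (c n))).const_mul (w n)
  exact HasDerivAt.congr_deriv this (by simp only [mul_one]; ring)

lemma hasDerivAt_sech (t : ℝ) : HasDerivAt sech (-(sech t * Real.tanh t)) t := by
  have h := (Real.hasDerivAt_cosh t).inv (Real.cosh_pos t).ne'
  refine HasDerivAt.congr_deriv (f := sech) h ?_
  rw [Real.tanh_eq_sinh_div_cosh, sech]
  have := (Real.cosh_pos t).ne'
  field_simp

lemma hasDerivAt_sech_mul_tanh (t : ℝ) :
    HasDerivAt (fun t => sech t * Real.tanh t) (2 * sech t ^ 3 - sech t) t := by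
  have hc := (Real.cosh_pos t).ne'
  have h := ((Real.hasDerivAt_sinh t).div (Real.hasDerivAt_cosh t) hc).congr_of_eventuallyEq
    (Eventually.of_forall fun t => Real.tanh_eq_sinh_div_cosh t : Real.tanh =ᶠ[𝓝 t] _)
  have h2 := (hasDerivAt_sech t).mul h
  refine HasDerivAt.congr_deriv (f := fun t => sech t * Real.tanh t) h2 ?_
  rw [Real.tanh_eq_sinh_div_cosh, sech]
  field_simp
  have := Real.cosh_sq t
  linear_combination 2 * this

lemma expDecay_deriv_sech_mul_tanh : ExpDecay fun t => 2 * sech t ^ 3 - sech t := by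
  have : (fun t => 2 * sech t ^ 3 - sech t) = fun t => sech t * (2 * sech t ^ 2 - 1) := by
    ext t; ring
  rw [this]
  refine expDecay_sech.mul_bounded (B := 1) fun t => ?_
  have h1 := sech_le_one t
  have h2 := sech_pos t
  rw [abs_le]
  constructor <;> nlinarith

/-- The derivative of `sechSum`. -/
noncomputable def sechSumDeriv (P : ℝ) : ℝ := ∑' n : ℤ, (n:ℝ) * -(sech (n * P) * Real.tanh (n * P))

/-- The derivative of `sechOddSum`. -/
noncomputable def sechOddSumDeriv (P : ℝ) : ℝ :=
  ∑' n : ℤ, (2 * (n:ℝ) + 1) * -(sech ((2 * n + 1) * P) * Real.tanh ((2 * n + 1) * P))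

lemma hasDerivAt_sechSum {P : ℝ} (hP : 0 < P) : HasDerivAt sechSum (sechSumDeriv P) P := by
  have h := expDecay_sech.hasDerivAt_tsum expDecay_sech_mul_tanh.neg hasDerivAt_sech
    (c := fun n => n) (w := fun _ => 1) (A := 1) (fun n => le_rfl) (fun n => by simp)
    (fun n => by simp) hP
  simp only [one_mul] at h
  have e : sechSum = fun P => ∑' n : ℤ, sech (n * P) := by
    ext P; simp [sechSum, latticeSum]
  rw [e]
  exact h

lemma sechOddSum_eq : sechOddSum = fun P => ∑' n : ℤ, sech ((2 * n + 1) * P) := by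
  ext P
  rw [sechOddSum, latticeSum]
  refine tsum_congr fun n => ?_
  ring_nf

lemma abs_two_mul_add_one (n : ℤ) :
    |(n:ℝ)| ≤ |2 * (n:ℝ) + 1| ∧ 1 ≤ |2 * (n:ℝ) + 1| ∧ |(n:ℝ)| - 1 ≤ |2 * (n:ℝ) + 1| - 1 ∧
      |2 * (n:ℝ) + 1| ≤ 2 * (1 + |(n:ℝ)|) := by
  have h : |n| ≤ |2 * n + 1| ∧ 1 ≤ |2 * n + 1| ∧ |n| - 1 ≤ |2 * n + 1| - 1 ∧
      |2 * n + 1| ≤ 2 * (1 + |n|) := by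
    rcases abs_cases n with ⟨h1, h2⟩ | ⟨h1, h2⟩ <;>
    rcases abs_cases (2 * n + 1) with ⟨h3, h4⟩ | ⟨h3, h4⟩ <;> omega
  exact_mod_cast h

lemma hasDerivAt_sechOddSum {P : ℝ} (hP : 0 < P) :
    HasDerivAt sechOddSum (sechOddSumDeriv P) P := by
  have h := expDecay_sech.hasDerivAt_tsum expDecay_sech_mul_tanh.neg hasDerivAt_sech
    (c := fun n => 2 * (n:ℝ) + 1) (w := fun _ => 1) (A := 2) (fun n => (abs_two_mul_add_one n).1)
    (fun n => by rw [abs_one]; linarith [abs_nonneg (n:ℝ)])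
    (fun n => by rw [one_mul]; exact (abs_two_mul_add_one n).2.2.2) hP
  simp only [one_mul] at h
  rw [sechOddSum_eq]
  exact h

lemma tendsto_sechSumDeriv : Tendsto sechSumDeriv atTop (𝓝 0) := by
  have h := expDecay_sech_mul_tanh.neg.tendsto_exp_mul_tsum (c := fun n => n)
    (w := fun n => n) (L := fun n => 0) (k := 0) (A := 1) (fun n => abs_nonneg _)
    (fun n => by linarith) (fun n => by simp) (fun n hn => ?_) (fun n hn => rfl)
  · simp only [zero_mul, Real.exp_zero, one_mul, tsum_zero] at h
    exact h
  · have : n = 0 := by simpa using hn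
    simp [this]

lemma tendsto_exp_mul_sech : Tendsto (fun P => Real.exp P * sech P) atTop (𝓝 2) := by
  have h : Tendsto (fun t : ℝ => 2 / (1 + Real.exp (-(2 * t)))) atTop (𝓝 (2 / (1 + 0))) :=
    tendsto_const_nhds.div (tendsto_const_nhds.add
      (Real.tendsto_exp_neg_atTop_nhds_zero.comp tendsto_two_mul_atTop)) (by norm_num)
  simp only [add_zero, div_one] at h
  refine h.congr fun t => ?_
  have h3 : Real.exp (-(2 * t)) = Real.exp (-t) / Real.exp t := by
    rw [← Real.exp_sub]; ring_nf
  rw [sech, Real.cosh_eq, h3]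
  have := Real.exp_pos t
  have := Real.exp_pos (-t)
  field_simp

lemma tendsto_exp_mul_sech_mul_tanh :
    Tendsto (fun P => Real.exp P * (sech P * Real.tanh P)) atTop (𝓝 2) := by
  have := tendsto_exp_mul_sech.mul tendsto_tanh_atTop
  simpa only [mul_assoc, mul_one] using this

lemma abs_two_mul_add_one_eq_one {n : ℤ} : |2 * (n:ℝ) + 1| = 1 ↔ n = 0 ∨ n = -1 := by
  have h : |2 * n + 1| = 1 ↔ n = 0 ∨ n = -1 := by
    rcases abs_cases (2 * n + 1) with ⟨h3, h4⟩ | ⟨h3, h4⟩ <;> omega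
  rw [← h]
  exact_mod_cast Iff.rfl

lemma tsum_ite_zero_or_neg_one (a : ℝ) :
    ∑' n : ℤ, (if n = 0 ∨ n = -1 then a else 0) = 2 * a := by
  rw [tsum_eq_sum (s := {0, -1}) (fun n hn => by
    rw [if_neg]; simpa using hn), Finset.sum_pair (by norm_num)]
  simp; ring

lemma tendsto_exp_mul_sechOddSum :
    Tendsto (fun P => Real.exp P * sechOddSum P) atTop (𝓝 4) := by
  have h := expDecay_sech.tendsto_exp_mul_tsum (c := fun n => 2 * (n:ℝ) + 1)
    (w := fun n => 1) (L := fun n => if n = 0 ∨ n = -1 then 2 else 0) (k := 1) (A := 1)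
    (fun n => (abs_two_mul_add_one n).2.1)
    (fun n => (abs_two_mul_add_one n).2.2.1) (fun n => by simp) (fun n hn => ?_) (fun n hn => ?_)
  · rw [tsum_ite_zero_or_neg_one] at h
    simp only [one_mul] at h
    rw [sechOddSum_eq]
    convert h using 2
    norm_num
  · have h0 := abs_two_mul_add_one_eq_one.mp hn
    rw [if_pos h0]
    refine tendsto_exp_mul_sech.congr fun P => ?_
    rcases h0 with rfl | rfl
    · simp
    · norm_num [sech_neg]
  · rw [if_neg]; rwa [← abs_two_mul_add_one_eq_one]

lemma tendsto_exp_mul_sechOddSumDeriv :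
    Tendsto (fun P => Real.exp P * sechOddSumDeriv P) atTop (𝓝 (-4)) := by
  have h := expDecay_sech_mul_tanh.neg.tendsto_exp_mul_tsum (c := fun n => 2 * (n:ℝ) + 1)
    (w := fun n => 2 * (n:ℝ) + 1) (L := fun n => if n = 0 ∨ n = -1 then -2 else 0) (k := 1)
    (A := 2) (fun n => (abs_two_mul_add_one n).2.1)
    (fun n => (abs_two_mul_add_one n).2.2.1) (fun n => (abs_two_mul_add_one n).2.2.2)
    (fun n hn => ?_) (fun n hn => ?_)
  · rw [tsum_ite_zero_or_neg_one] at h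
    simp only [one_mul] at h
    simp only [sechOddSumDeriv]
    convert h using 2
    norm_num
  · have h0 := abs_two_mul_add_one_eq_one.mp hn
    rw [if_pos h0]
    refine tendsto_exp_mul_sech_mul_tanh.neg.congr fun P => ?_
    rcases h0 with rfl | rfl
    · simp
    · norm_num [sech_neg, Real.tanh_neg]
  · rw [if_neg]; rwa [← abs_two_mul_add_one_eq_one]

/-- The derivative of the ratio `E / D`, before simplification. -/
noncomputable def sechRatioDeriv (P : ℝ) : ℝ :=
  2 * ((2 * sechSumDeriv (2 * P)) * sechOddSum P - sechSum (2 * P) * sechOddSumDeriv P)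
    / sechSum P ^ 2

lemma hasDerivAt_sechRatio_aux {P : ℝ} (hP : 0 < P) :
    HasDerivAt sechRatio (sechRatioDeriv P) P := by
  have h2P : 0 < 2 * P := by positivity
  have hV : HasDerivAt (fun P => sechSum (2 * P)) (sechSumDeriv (2 * P) * 2) P := by
    have := (hasDerivAt_sechSum h2P).comp P ((hasDerivAt_id P).const_mul 2)
    exact HasDerivAt.congr_deriv this (by ring)
  have hO := hasDerivAt_sechOddSum hP
  have hne : sechSum (2 * P) + sechOddSum P ≠ 0 := by
    rw [← sechSum_eq_add hP]; exact (sechSum_pos hP).ne'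
  have h := (hV.sub hO).div (hV.add hO) hne
  have h2 : HasDerivAt sechRatio _ P := h.congr_of_eventuallyEq (by
    filter_upwards [lt_mem_nhds hP] with P hP
    simp only [sechRatio, sechAltSum, Pi.div_apply, Pi.sub_apply, Pi.add_apply]
    rw [sechSum_eq_add hP])
  refine h2.congr_deriv ?_
  simp only [Pi.sub_apply, Pi.add_apply]
  rw [sechRatioDeriv, sechSum_eq_add hP]
  congr 1
  ring

lemma sechRatio_double_sq {P : ℝ} (hP : 0 < P) :
    sechRatio (2 * P) ^ 2 = 4 * sechRatio P / (1 + sechRatio P) ^ 2 := by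
  have hD := sechSum_pos hP
  have hE := sechAltSum_pos hP
  have hD2 : sechSum (2 * P) = (sechSum P + sechAltSum P) / 2 := by
    rw [sechSum_eq_add hP, sechAltSum]; ring
  rw [sechRatio, sechRatio, div_pow, sechAltSum_sq hP, hD2]
  field_simp
  norm_num

lemma sechRatioDeriv_double {P : ℝ} (hP : 0 < P) :
    sechRatio (2 * P) * sechRatioDeriv (2 * P)
      = sechRatioDeriv P * (1 - sechRatio P) / (1 + sechRatio P) ^ 3 := by
  have h2P : 0 < 2 * P := by positivity
  have hb := sechRatio_pos hP
  have h1 : HasDerivAt (fun P => sechRatio (2 * P) ^ 2)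
      (2 * sechRatio (2 * P) * (sechRatioDeriv (2 * P) * 2)) P := by
    have := ((hasDerivAt_sechRatio_aux h2P).comp P ((hasDerivAt_id P).const_mul 2)).pow 2
    exact HasDerivAt.congr_deriv this (by simp)
  have h3 := hasDerivAt_sechRatio_aux hP
  have h4 := ((h3.const_mul 4).div ((h3.const_add 1).pow 2) (by simp only [Pi.pow_apply]; positivity))
  have h5 := h4.congr_of_eventuallyEq (f₁ := fun P => sechRatio (2 * P) ^ 2) (by
    filter_upwards [lt_mem_nhds hP] with P hP
    exact sechRatio_double_sq hP)
  have h6 := h1.unique h5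
  have e : 4 * (sechRatio (2 * P) * sechRatioDeriv (2 * P))
    = 2 * sechRatio (2 * P) * (sechRatioDeriv (2 * P) * 2) := by ring
  rw [h6] at e
  simp only [Pi.pow_apply] at e
  have : 1 + sechRatio P ≠ 0 := by positivity
  field_simp at e ⊢
  push_cast at e
  refine mul_left_cancel₀ this ?_
  linear_combination e

lemma hasDerivAt_sechRatio {P : ℝ} (hP : 0 < P) :
    HasDerivAt sechRatio (sechRatio P * (sechSum P ^ 2 - sechAltSum P ^ 2) / 2) P := by
  refine (hasDerivAt_sechRatio_aux hP).congr_deriv ?_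
  have hsq {P : ℝ} (hP : 0 < P) : 0 < sechSum P ^ 2 - sechAltSum P ^ 2 := by
    have := sechAltSum_lt hP
    have := sechAltSum_pos hP
    nlinarith
  have h := eq_of_tendsto_of_double (L := 1 / 2)
    (g := fun P => sechRatioDeriv P / (sechRatio P * (sechSum P ^ 2 - sechAltSum P ^ 2)))
    (fun P hP => ?_) ?_ hP
  · have h1 := hsq hP
    have h2 := sechRatio_pos hP
    rw [div_eq_iff (by positivity)] at h
    rw [h]; ring
  · have h2P : 0 < 2 * P := by positivity
    have hD := sechSum_pos hP
    have hb := sechRatio_pos hP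
    have hb1 := sechRatio_lt_one hP
    have hb2 := sechRatio_pos h2P
    have hE : sechAltSum P = sechRatio P * sechSum P := by
      rw [sechRatio]; field_simp
    have hO : sechOddSum P = sechSum P * (1 - sechRatio P) / 2 := by
      have h1 := sechSum_eq_add hP
      have h2 : sechAltSum P = sechSum (2 * P) - sechOddSum P := rfl
      linear_combination (-h1 + h2 - hE) / 2
    rw [← sechOddSum_sq hP, hO, hE]
    have e := sechRatioDeriv_double hP
    have e2 := sechRatio_double_sq hP
    have e3 : sechRatioDeriv (2 * P) = sechRatioDeriv P * (1 - sechRatio P)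
        / (1 + sechRatio P) ^ 3 / sechRatio (2 * P) := by
      rw [← e]; field_simp
    have hne : 1 - sechRatio P ≠ 0 := by linarith
    have hne2 : sechSum P ^ 2 - (sechRatio P * sechSum P) ^ 2 ≠ 0 := by
      rw [← hE]; exact (hsq hP).ne'
    have e4 : sechRatio (2 * P) * sechRatio (2 * P) = 4 * sechRatio P / (1 + sechRatio P) ^ 2 := by
      rw [← e2, sq]
    rw [e3, div_div, div_div]
    rw [div_eq_div_iff (by positivity) (by positivity)]
    rw [show (1 + sechRatio P) ^ 3 * (sechRatio (2 * P) *
      (sechRatio (2 * P) * (sechSum P * (1 - sechRatio P) / 2) ^ 2)) =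
      (1 + sechRatio P) ^ 3 * ((sechRatio (2 * P) * sechRatio (2 * P)) *
       (sechSum P * (1 - sechRatio P) / 2) ^ 2) by ring, e4]
    have : 1 + sechRatio P ≠ 0 := by positivity
    field_simp
    ring
  · have hV := tendsto_sechSum.comp tendsto_two_mul_atTop
    have hV' := tendsto_sechSumDeriv.comp tendsto_two_mul_atTop
    have hlim := ((((hV'.const_mul 2).mul tendsto_exp_mul_sechOddSum).sub
      (hV.mul tendsto_exp_mul_sechOddSumDeriv)).const_mul 2).div
      ((tendsto_sechSum.pow 2).mul (tendsto_sechRatio.mul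
        ((hV.mul tendsto_exp_mul_sechOddSum).const_mul 4))) (by norm_num)
    norm_num at hlim
    refine hlim.congr' ?_
    filter_upwards [eventually_gt_atTop 0] with P hP
    have hx := Real.exp_pos P
    have hD := sechSum_pos hP
    have hO := sechOddSum_pos hP
    have hV := sechSum_pos (show 0 < 2 * P by positivity)
    have hb := sechRatio_pos hP
    have e : sechSum P ^ 2 - sechAltSum P ^ 2 = 4 * sechSum (2 * P) * sechOddSum P := by
      rw [sechSum_eq_add hP, sechAltSum]; ring
    rw [e, sechRatioDeriv]
    simp only [Pi.div_apply]
    field_simp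

/-- `∑ (-1)ⁿ f((4n+1)y)`. -/
noncomputable def quarterSum (f : ℝ → ℝ) (y : ℝ) : ℝ :=
  ∑' n : ℤ, (-1:ℝ) ^ n * f ((4 * n + 1) * y)

lemma abs_four_mul_add_one (n : ℤ) :
    |(n:ℝ)| ≤ |4 * (n:ℝ) + 1| ∧ 1 ≤ |4 * (n:ℝ) + 1| ∧ |(n:ℝ)| - 1 ≤ |4 * (n:ℝ) + 1| - 1 ∧
      |4 * (n:ℝ) + 1| ≤ 4 * (1 + |(n:ℝ)|) := by
  have h : |n| ≤ |4 * n + 1| ∧ 1 ≤ |4 * n + 1| ∧ |n| - 1 ≤ |4 * n + 1| - 1 ∧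
      |4 * n + 1| ≤ 4 * (1 + |n|) := by
    rcases abs_cases n with ⟨h1, h2⟩ | ⟨h1, h2⟩ <;>
    rcases abs_cases (4 * n + 1) with ⟨h3, h4⟩ | ⟨h3, h4⟩ <;> omega
  exact_mod_cast h

lemma abs_neg_one_zpow_real (n : ℤ) : |(-1:ℝ) ^ n| = 1 := by
  rw [abs_zpow]; simp

lemma ExpDecay.quarterSum_summable {f : ℝ → ℝ} (hf : ExpDecay f) {y : ℝ} (hy : 0 < y) :
    Summable fun n : ℤ => (-1:ℝ) ^ n * f ((4 * n + 1) * y) := by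
  refine Summable.of_norm_bounded (hf.summable (show 0 < 4 * y by positivity) y).norm fun n => ?_
  rw [norm_mul, Real.norm_eq_abs, abs_neg_one_zpow_real, one_mul]
  ring_nf
  rfl

lemma ExpDecay.quarterSum_eq {f : ℝ → ℝ} (hf : ExpDecay f) {y : ℝ} (hy : 0 < y) :
    quarterSum f y = latticeSum f (2 * (2 * (2 * y))) y
      - latticeSum f (2 * (2 * (2 * y))) (y + 2 * (2 * y)) := by
  rw [quarterSum, tsum_int_even_add_odd (hf.quarterSum_summable hy), sub_eq_add_neg, latticeSum,
    latticeSum, ← tsum_neg]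
  congr 1 <;> refine tsum_congr fun n => ?_
  · rw [zpow_mul]; norm_num; ring_nf
  · rw [zpow_add₀ (by norm_num), zpow_mul]; norm_num; ring_nf

lemma quarterSum_sech_sq {y : ℝ} (hy : 0 < y) :
    quarterSum sech y ^ 2
      = sechAltSum (2 * y) * (sechSum (2 * y) - sechAltSum (2 * y)) / 2 := by
  have h2 : 0 < 2 * y := by positivity
  have h4 : 0 < 2 * (2 * y) := by positivity
  have e1 := expDecay_sech.quarterSum_eq hy
  have e2 := expDecay_sech.latticeSum_split h4 y
  have e3 := latticeSum_mul_half_period h4 y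
  have e4 := latticeSum_mul_half_period h2 (-y)
  rw [latticeSum_neg sech_neg, show -y + 2 * y = y by ring] at e4
  have e5 := sechOddSum_sq h2
  have e6 := sechSum_eq_add h4
  have e7 : sechAltSum (2 * (2 * y)) = sechSum (2 * (2 * (2 * y))) - sechOddSum (2 * (2 * y)) := rfl
  have e8 : sechAltSum (2 * y) = sechSum (2 * (2 * y)) - sechOddSum (2 * y) := rfl
  have e9 := sechSum_eq_add h2
  change _ = sechSum (2 * (2 * (2 * y))) * sechOddSum (2 * (2 * y)) at e3
  change _ = sechSum (2 * (2 * y)) * sechOddSum (2 * y) at e4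
  rw [e7, e6] at e5
  rw [e2] at e4
  rw [e1, e8, e9]
  linear_combination e4 - 4 * e3 + e5

lemma quarterSum_deriv {y : ℝ} (hy : 0 < y) :
    quarterSum (fun t => 2 * sech t ^ 3 - sech t) y
      = quarterSum sech y * ((sechSum (2 * y) - 3 * sechAltSum (2 * y))
        * (sechSum (2 * y) + sechAltSum (2 * y)) / 4) := by
  have h2 : 0 < 2 * y := by positivity
  have h4 : 0 < 2 * (2 * y) := by positivity
  have h8 : 0 < 2 * (2 * (2 * y)) := by positivity
  have e0 : quarterSum (fun t => 2 * sech t ^ 3 - sech t) y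
      = 2 * quarterSum (fun t => sech t ^ 3) y - quarterSum sech y := by
    rw [quarterSum, quarterSum, quarterSum, ← tsum_mul_left,
      ← ((expDecay_sech_cube.quarterSum_summable hy).mul_left 2).tsum_sub
        (expDecay_sech.quarterSum_summable hy)]
    refine tsum_congr fun n => ?_
    ring
  have hsq := quarterSum_sech_sq hy
  have e1 := expDecay_sech.quarterSum_eq hy
  have e2 := expDecay_sech_cube.quarterSum_eq hy
  have c1 := latticeSum_sech_cube_eq h8 y
  have c2 := latticeSum_sech_cube_eq h8 (y + 2 * (2 * y))
  have e3 := latticeSum_mul_half_period h4 y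
  change _ = sechSum (2 * (2 * (2 * y))) * sechOddSum (2 * (2 * y)) at e3
  have e5 := sechOddSum_sq h4
  have e6 := sechSum_eq_add h4
  have e7 : sechAltSum (2 * (2 * y)) = sechSum (2 * (2 * (2 * y))) - sechOddSum (2 * (2 * y)) := rfl
  have e8 : sechAltSum (2 * y) = sechSum (2 * (2 * y)) - sechOddSum (2 * y) := rfl
  have e9 := sechSum_eq_add h2
  have e10 := sechAltSum_sq h2
  have e11 : sechSum (2 * (2 * y)) = (sechSum (2 * y) + sechAltSum (2 * y)) / 2 := by
    rw [e8, e9]; ring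
  rw [e11] at e6
  rw [e7] at e10
  rw [e0, e2, mul_sub, c1, c2]
  generalize latticeSum sech (2 * (2 * (2 * y))) y = d1 at *
  generalize latticeSum sech (2 * (2 * (2 * y))) (y + 2 * (2 * y)) = d2 at *
  generalize sechSum (2 * (2 * (2 * y))) = X at *
  generalize sechOddSum (2 * (2 * y)) = Z at *
  generalize sechAltSum (2 * (2 * (2 * y))) = E at *
  generalize sechSum (2 * y) = a at *
  generalize sechAltSum (2 * y) = b at *
  rw [e1] at hsq ⊢
  linear_combination (d1 - d2) * (2 * hsq + 6 * e3 + e5 - 2 * e10 - (X + Z + (a + b) / 2) * e6)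

lemma hasDerivAt_quarterSum_sech {y : ℝ} (hy : 0 < y) : ∃ d, HasDerivAt (quarterSum sech) d y :=
  ⟨_, expDecay_sech.hasDerivAt_tsum expDecay_sech_mul_tanh.neg hasDerivAt_sech
    (c := fun n => 4 * (n:ℝ) + 1) (w := fun n => (-1:ℝ) ^ n) (A := 4)
    (fun n => (abs_four_mul_add_one n).1)
    (fun n => by rw [abs_neg_one_zpow_real]; linarith [abs_nonneg (n:ℝ)])
    (fun n => by
      rw [abs_mul, abs_neg_one_zpow_real, one_mul]; exact (abs_four_mul_add_one n).2.2.2) hy⟩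

lemma abs_four_mul_add_one_eq_one {n : ℤ} : |4 * (n:ℝ) + 1| = 1 ↔ n = 0 := by
  have h : |4 * n + 1| = 1 ↔ n = 0 := by
    rcases abs_cases (4 * n + 1) with ⟨h3, h4⟩ | ⟨h3, h4⟩ <;> omega
  rw [← h]
  exact_mod_cast Iff.rfl

lemma tendsto_exp_mul_quarterSum_sech :
    Tendsto (fun y => Real.exp y * quarterSum sech y) atTop (𝓝 2) := by
  have h := expDecay_sech.tendsto_exp_mul_tsum (c := fun n => 4 * (n:ℝ) + 1)
    (w := fun n => (-1:ℝ) ^ n) (L := fun n => if n = 0 then 2 else 0) (k := 1) (A := 1)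
    (fun n => (abs_four_mul_add_one n).2.1)
    (fun n => (abs_four_mul_add_one n).2.2.1)
    (fun n => by rw [abs_neg_one_zpow_real]; linarith [abs_nonneg (n:ℝ)])
    (fun n hn => ?_) (fun n hn => ?_)
  · rw [tsum_ite_eq] at h
    simp only [one_mul] at h
    exact h
  · have h0 := abs_four_mul_add_one_eq_one.mp hn
    rw [if_pos h0]
    refine tendsto_exp_mul_sech.congr fun P => ?_
    simp [h0]
  · rw [if_neg]; rwa [← abs_four_mul_add_one_eq_one]

lemma quarterSum_sech_pos {y : ℝ} (hy : 0 < y) : 0 < quarterSum sech y := by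
  have hne {z : ℝ} (hz : 0 < z) : quarterSum sech z ≠ 0 := by
    have h2 : 0 < 2 * z := by positivity
    have h := quarterSum_sech_sq hz
    have h3 : 0 < quarterSum sech z ^ 2 := by
      rw [h]
      have := sub_pos.mpr (sechAltSum_lt h2)
      have := sechAltSum_pos h2
      positivity
    exact fun h0 => by simp [h0] at h3
  by_contra hcon
  have hneg := lt_of_le_of_ne (not_lt.mp hcon) (hne hy)
  obtain ⟨z, hz, hyz⟩ := ((tendsto_exp_mul_quarterSum_sech.eventually
    (lt_mem_nhds (show (0:ℝ) < 2 by norm_num))).and (eventually_gt_atTop y)).exists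
  have hz' : 0 < quarterSum sech z := (pos_iff_pos_of_mul_pos hz).mp (Real.exp_pos z)
  have hcont : ContinuousOn (quarterSum sech) (Set.Icc y z) := fun w hw =>
    (hasDerivAt_quarterSum_sech (hy.trans_le hw.1)).choose_spec.continuousAt.continuousWithinAt
  obtain ⟨w, hw, hw0⟩ := intermediate_value_Icc hyz.le hcont ⟨hneg.le, hz'.le⟩
  exact hne (hy.trans_le hw.1) hw0

/-- `∑ (-1)ⁿ/(4n+1) · sech((4n+1)y) tanh((4n+1)y)`. -/
noncomputable def quarterPrimitive (y : ℝ) : ℝ :=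
  ∑' n : ℤ, (-1:ℝ) ^ n / (4 * n + 1) * (sech ((4 * n + 1) * y) * Real.tanh ((4 * n + 1) * y))

lemma four_mul_add_one_ne_zero (n : ℤ) : 4 * (n:ℝ) + 1 ≠ 0 := by
  have := (abs_four_mul_add_one n).2.1
  intro h
  rw [h] at this
  norm_num at this

lemma abs_neg_one_zpow_div_le (n : ℤ) :
    |(-1:ℝ) ^ n / (4 * n + 1)| ≤ 1 := by
  rw [abs_div, abs_neg_one_zpow_real]
  have := (abs_four_mul_add_one n).2.1
  rw [div_le_one (by linarith)]
  exact this

lemma hasDerivAt_quarterPrimitive {y : ℝ} (hy : 0 < y) :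
    HasDerivAt quarterPrimitive
      (Real.sqrt (sechAltSum (2 * y) * (sechSum (2 * y) - sechAltSum (2 * y)) / 2)
        * ((sechSum (2 * y) - 3 * sechAltSum (2 * y))
        * (sechSum (2 * y) + sechAltSum (2 * y)) / 4)) y := by
  have h := expDecay_sech_mul_tanh.hasDerivAt_tsum expDecay_deriv_sech_mul_tanh
    hasDerivAt_sech_mul_tanh
    (c := fun n => 4 * (n:ℝ) + 1) (w := fun n => (-1:ℝ) ^ n / (4 * n + 1)) (A := 1)
    (fun n => (abs_four_mul_add_one n).1)
    (fun n => by linarith [abs_nonneg (n:ℝ), abs_neg_one_zpow_div_le n])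
    (fun n => by
      rw [div_mul_cancel₀ _ (four_mul_add_one_ne_zero n), abs_neg_one_zpow_real]
      linarith [abs_nonneg (n:ℝ)]) hy
  refine HasDerivAt.congr_deriv (f := quarterPrimitive) h ?_
  rw [← quarterSum_sech_sq hy, Real.sqrt_sq (quarterSum_sech_pos hy).le, ← quarterSum_deriv hy,
    quarterSum]
  refine tsum_congr fun n => ?_
  rw [div_mul_cancel₀ _ (four_mul_add_one_ne_zero n)]

lemma tendsto_quarterPrimitive : Tendsto quarterPrimitive atTop (𝓝 0) := by
  have h := expDecay_sech_mul_tanh.tendsto_exp_mul_tsum (c := fun n => 4 * (n:ℝ) + 1)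
    (w := fun n => (-1:ℝ) ^ n / (4 * n + 1)) (L := fun n => 0) (k := 0) (A := 1)
    (fun n => abs_nonneg _)
    (fun n => by linarith [(abs_four_mul_add_one n).1])
    (fun n => by linarith [abs_nonneg (n:ℝ), abs_neg_one_zpow_div_le n])
    (fun n hn => by linarith [(abs_four_mul_add_one n).2.1]) (fun n hn => rfl)
  simp only [zero_mul, Real.exp_zero, one_mul, tsum_zero] at h
  exact h

/-- The integrand `(3u-1)/√(u(1-u)) · ₂F₁(1/2,1/2;1;1-u²)`. -/
noncomputable def landenIntegrand (u : ℝ) : ℝ :=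
  (3 * u - 1) / Real.sqrt (u * (1 - u)) * hyp2F1half (1 - u ^ 2)

lemma continuousOn_hyp2F1half_one_sub_sq :
    ContinuousOn (fun u : ℝ => hyp2F1half (1 - u ^ 2)) (Set.Ioc 0 1) := by
  refine continuousOn_hyp2F1half.comp (by fun_prop) fun u hu => ?_
  have h1 := hu.1
  have h2 := hu.2
  constructor <;> nlinarith

lemma continuousAt_landenIntegrand {u : ℝ} (h0 : 0 < u) (h1 : u < 1) :
    ContinuousAt landenIntegrand u := by
  have h2 : 0 < u * (1 - u) := mul_pos h0 (by linarith)
  have h3 : ContinuousAt (fun u : ℝ => hyp2F1half (1 - u ^ 2)) u :=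
    continuousOn_hyp2F1half_one_sub_sq.continuousAt (Ioc_mem_nhds h0 h1)
  refine ContinuousAt.mul (ContinuousAt.div (by fun_prop) (by fun_prop) ?_) h3
  exact (Real.sqrt_pos.mpr h2).ne'

lemma intervalIntegrable_landenIntegrand {c : ℝ} (h0 : 0 < c) (h1 : c ≤ 1) :
    IntervalIntegrable landenIntegrand MeasureTheory.volume c 1 := by
  have hr : IntervalIntegrable (fun u : ℝ => (1 - u) ^ (-(1 / 2) : ℝ)) MeasureTheory.volume c 1 := by
    have := (intervalIntegral.intervalIntegrable_rpow' (a := 1 - c) (b := 0)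
      (r := -(1 / 2)) (by norm_num)).comp_sub_left 1
    simpa using this
  have hg : ContinuousOn (fun u : ℝ => (3 * u - 1) / Real.sqrt u * hyp2F1half (1 - u ^ 2))
      (Set.uIcc c 1) := by
    rw [Set.uIcc_of_le h1]
    refine ContinuousOn.mul (ContinuousOn.div (by fun_prop) (by fun_prop) fun u hu => ?_)
      (continuousOn_hyp2F1half_one_sub_sq.mono fun u hu => ⟨h0.trans_le hu.1, hu.2⟩)
    exact (Real.sqrt_pos.mpr (h0.trans_le hu.1)).ne'
  refine (hr.continuousOn_mul hg).congr fun u hu => ?_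
  rw [Set.uIoc_of_le h1] at hu
  have hu0 : 0 < u := h0.trans hu.1
  have hu1 : 0 ≤ 1 - u := by linarith [hu.2]
  simp only [landenIntegrand]
  rw [Real.sqrt_mul hu0.le, Real.rpow_neg hu1, ← Real.sqrt_eq_rpow, div_mul_eq_div_div,
    div_eq_mul_inv _ (Real.sqrt (1 - u))]
  ring

lemma hasDerivAt_integral_sechRatio {y : ℝ} (hy : 0 < y) :
    HasDerivAt (fun y => ∫ u in sechRatio (2 * y)..1, landenIntegrand u)
      (Real.sqrt (sechAltSum (2 * y) * (sechSum (2 * y) - sechAltSum (2 * y)))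
        * ((sechSum (2 * y) - 3 * sechAltSum (2 * y))
        * (sechSum (2 * y) + sechAltSum (2 * y)))) y := by
  have h2 : 0 < 2 * y := by positivity
  have hb := sechRatio_pos h2
  have hb1 := sechRatio_lt_one h2
  have hd := (hasDerivAt_sechRatio h2).comp y ((hasDerivAt_id y).const_mul 2)
  have hc := continuousAt_landenIntegrand hb hb1
  have hm : StronglyMeasurableAtFilter landenIntegrand (𝓝 (sechRatio (2 * y))) :=
    ContinuousOn.stronglyMeasurableAtFilter (s := Set.Ioo 0 1) isOpen_Ioo
      (fun u hu => (continuousAt_landenIntegrand hu.1 hu.2).continuousWithinAt) _ ⟨hb, hb1⟩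
  have hi := intervalIntegral.integral_hasDerivAt_left
    (intervalIntegrable_landenIntegrand hb hb1.le) hm hc
  have hcomp := HasDerivAt.comp (h := sechRatio ∘ HMul.hMul 2) y hi hd
  refine HasDerivAt.congr_deriv (f := fun y => ∫ u in sechRatio (2 * y)..1, landenIntegrand u)
    hcomp ?_
  rw [landenIntegrand, hyp2F1half_sechRatio h2]
  have hD := sechSum_pos h2
  have hE : sechAltSum (2 * y) = sechRatio (2 * y) * sechSum (2 * y) := by
    rw [sechRatio]; field_simp
  rw [hE]
  generalize sechRatio (2 * y) = β at *
  generalize sechSum (2 * y) = a at *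
  have hs : β * a * (a - β * a) = a ^ 2 * (β * (1 - β)) := by ring
  rw [hs, Real.sqrt_mul (sq_nonneg a), Real.sqrt_sq hD.le]
  have hp : 0 < β * (1 - β) := mul_pos hb (by linarith)
  have hq := Real.sqrt_pos.mpr hp
  have hqq := Real.sq_sqrt hp.le
  field_simp
  rw [hqq]
  ring

lemma tendsto_integral_sechRatio :
    Tendsto (fun y => ∫ u in sechRatio (2 * y)..1, landenIntegrand u) atTop (𝓝 0) := by
  have hc := intervalIntegral.continuousOn_primitive_interval'
    (intervalIntegrable_landenIntegrand (c := 1 / 2) (by norm_num) (by norm_num))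
    (a := 1) (by simp)
  have h1 := hc 1 (by simp)
  rw [ContinuousWithinAt, intervalIntegral.integral_same] at h1
  have h2 : Tendsto (fun y => sechRatio (2 * y)) atTop (𝓝[Set.uIcc (1 / 2) 1] 1) := by
    have h3 := tendsto_sechRatio.comp tendsto_two_mul_atTop
    refine tendsto_nhdsWithin_iff.mpr ⟨h3, ?_⟩
    filter_upwards [h3.eventually (lt_mem_nhds (show (1/2:ℝ) < 1 by norm_num)),
      eventually_gt_atTop 0] with y hy hy0
    rw [Set.uIcc_of_le (by norm_num)]
    exact ⟨hy.le, (sechRatio_lt_one (by positivity)).le⟩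
  have h3 := (h1.comp h2).neg
  rw [neg_zero] at h3
  refine h3.congr fun y => ?_
  rw [intervalIntegral.integral_symm, Function.comp]

lemma integral_sechRatio_eq {y : ℝ} (hy : 0 < y) :
    ∫ u in sechRatio (2 * y)..1, landenIntegrand u = 4 * Real.sqrt 2 * quarterPrimitive y := by
  set g : ℝ → ℝ := fun y => (∫ u in sechRatio (2 * y)..1, landenIntegrand u)
    - 4 * Real.sqrt 2 * quarterPrimitive y with hg
  have hd {z : ℝ} (hz : 0 < z) : HasDerivAt g 0 z := by
    refine HasDerivAt.congr_deriv (f := g) ((hasDerivAt_integral_sechRatio hz).sub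
      ((hasDerivAt_quarterPrimitive hz).const_mul (4 * Real.sqrt 2))) ?_
    have h2 : 0 < 2 * z := by positivity
    have h3 := sub_pos.mpr (sechAltSum_lt h2)
    have h4 := sechAltSum_pos h2
    rw [Real.sqrt_div (by positivity)]
    field_simp
    ring
  have hconst {z : ℝ} (hz : y ≤ z) : g z = g y :=
    constant_of_has_deriv_right_zero
      (fun w hw => (hd (hy.trans_le hw.1)).continuousAt.continuousWithinAt)
      (fun w hw => (hd (hy.trans_le hw.1)).hasDerivWithinAt) z ⟨hz, le_rfl⟩
  have hl : Tendsto g atTop (𝓝 0) := by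
    have := tendsto_integral_sechRatio.sub (tendsto_quarterPrimitive.const_mul (4 * Real.sqrt 2))
    rwa [mul_zero, sub_zero] at this
  have hl2 : Tendsto g atTop (𝓝 (g y)) := tendsto_const_nhds.congr' (by
    filter_upwards [eventually_ge_atTop y] with z hz using (hconst hz).symm)
  have := tendsto_nhds_unique hl2 hl
  linarith

/-- Summation along the bijection `ℕ ≃ ℤ` under which `2n+1` corresponds to `|4j+1|`. -/
lemma tsum_nat_eq_tsum_int {f : ℕ → ℝ} {g : ℤ → ℝ} (he : ∀ m : ℕ, f (2 * m) = g m)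
    (ho : ∀ m : ℕ, f (2 * m + 1) = g (Int.negSucc m)) : ∑' n, f n = ∑' j, g j := by
  rw [← Equiv.intEquivNat.tsum_eq]
  refine tsum_congr fun j => ?_
  cases j with
  | ofNat m => exact he m
  | negSucc m => exact ho m

lemma neg_one_pow_triangle_even (m : ℕ) :
    (-1:ℝ) ^ (2 * m * (2 * m + 1) / 2) = (-1) ^ (m : ℤ) := by
  have h : 2 * m * (2 * m + 1) / 2 = 2 * (m * m) + m := by
    rw [show 2 * m * (2 * m + 1) = 2 * (2 * (m * m) + m) by ring]; simp
  rw [h, pow_add, pow_mul]; simp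

lemma neg_one_pow_triangle_odd (m : ℕ) :
    (-1:ℝ) ^ ((2 * m + 1) * (2 * m + 1 + 1) / 2) = (-1) ^ (Int.negSucc m) := by
  have h : (2 * m + 1) * (2 * m + 1 + 1) / 2 = 2 * (m * m + m) + (m + 1) := by
    rw [show (2 * m + 1) * (2 * m + 1 + 1) = 2 * (2 * (m * m + m) + (m + 1)) by ring]; simp
  rw [h, pow_add, pow_mul, zpow_negSucc]
  simp [← inv_pow]

open Complex in
lemma tsum_one_div_sq_quarter {b : ℝ} (hb : 0 < b) :
    HasSum (fun n : ℤ => 1 / (((1 + b * I) / 4 : ℂ) + n) ^ 2)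
      (-4 * π ^ 2 * (I * Real.exp (-(π * b / 2)) / (1 - I * Real.exp (-(π * b / 2))) ^ 2)) := by
  set z : ℂ := (1 + b * I) / 4 with hz
  have hzim : 0 < z.im := by simp [hz]; exact hb
  have hs : Summable fun n : ℤ => 1 / (z + n) ^ 2 := by
    have := EisensteinSeries.linear_right_summable z 1 (k := 2) le_rfl
    refine this.congr fun n => ?_
    simp [zpow_ofNat]
  have h := EisensteinSeries.qExpansion_identity (k := 1) le_rfl ⟨z, hzim⟩
  have hr : cexp (2 * π * I * z) = I * Real.exp (-(π * b / 2)) := by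
    rw [show 2 * π * I * z = π / 2 * I + ((-(π * b / 2) : ℝ) : ℂ) by
      rw [hz]; push_cast; linear_combination (π * b / 2 : ℂ) * I_sq, Complex.exp_add,
      Complex.exp_pi_div_two_mul_I, Complex.ofReal_exp]
  have hnorm : ‖I * (Real.exp (-(π * b / 2)) : ℂ)‖ < 1 := by
    rw [norm_mul, norm_I, one_mul, norm_real, Real.norm_eq_abs, abs_of_pos (Real.exp_pos _),
      Real.exp_lt_one_iff]
    have := Real.pi_pos
    have : 0 < π * b / 2 := by positivity
    linarith
  have h2 := tsum_coe_mul_geometric_of_norm_lt_one hnorm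
  have h3 : ∑' n : ℤ, 1 / (z + n) ^ 2
      = -4 * π ^ 2 * (I * Real.exp (-(π * b / 2)) / (1 - I * Real.exp (-(π * b / 2))) ^ 2) := by
    rw [← h2, ← hr]
    simp only [pow_one, Nat.factorial_one, Nat.cast_one, div_one] at h
    refine h.trans ?_
    congr 1
    linear_combination (4 * π ^ 2 : ℂ) * I_sq
  rw [← h3]
  exact hs.hasSum

lemma hasSum_quarter_int {b : ℝ} (hb : 0 < b) :
    HasSum (fun n : ℤ => (4 * (n:ℝ) + 1) / ((4 * (n:ℝ) + 1) ^ 2 + b ^ 2) ^ 2)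
      (π ^ 2 / (16 * b) * (sech (π * b / 2) * Real.tanh (π * b / 2))) := by
  have h := (Complex.imCLM.hasSum (tsum_one_div_sq_quarter hb)).mul_left (-(1 / (32 * b)))
  refine HasSum.of_forall_eq (g := fun n : ℤ => -(1 / (32 * b)) * Complex.imCLM
    (1 / (((1 + b * Complex.I) / 4 : ℂ) + n) ^ 2)) ?_ fun n => ?_
  rotate_left
  · have hn : (((1 + b * Complex.I) / 4 : ℂ) + n) = ⟨(4 * (n:ℝ) + 1) / 4, b / 4⟩ := by
      apply Complex.ext <;> simp
      ring
    have hp : 0 < (4 * (n:ℝ) + 1) ^ 2 + b ^ 2 := by positivity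
    rw [hn, Complex.imCLM_apply, one_div (_ ^ 2 : ℂ), Complex.inv_im, map_pow, sq (_ : ℂ),
      Complex.mul_im, Complex.normSq_mk]
    have e : ((4 * (n:ℝ) + 1) / 4) * ((4 * (n:ℝ) + 1) / 4) + b / 4 * (b / 4)
        = ((4 * (n:ℝ) + 1) ^ 2 + b ^ 2) / 16 := by ring
    rw [e]
    field_simp
    ring
  · refine Eq.subst (motive := fun a => HasSum _ a) ?_ h
    set t := π * b / 2 with ht
    set ρ := Real.exp (-t) with hρ
    have hρ0 : 0 < ρ := Real.exp_pos _
    have e1 : Real.exp t = ρ⁻¹ := by rw [hρ, Real.exp_neg, inv_inv]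
    have hs : sech t * Real.tanh t = 2 * ρ * (1 - ρ ^ 2) / (1 + ρ ^ 2) ^ 2 := by
      rw [Real.tanh_eq_sinh_div_cosh, sech, Real.cosh_eq, Real.sinh_eq, e1, ← hρ]
      field_simp
    have him : (-4 * (π:ℂ) ^ 2 * (Complex.I * (ρ:ℂ) / (1 - Complex.I * (ρ:ℂ)) ^ 2))
        = ((-4 * π ^ 2 / (1 + ρ ^ 2) ^ 2 : ℝ) : ℂ) * ⟨-2 * ρ ^ 2, ρ * (1 - ρ ^ 2)⟩ := by
      have hc : (1 + (ρ:ℂ) ^ 2) ≠ 0 := by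
        have : (1 + ρ ^ 2 : ℝ) ≠ 0 := by positivity
        exact_mod_cast this
      have hc2 : (1 - Complex.I * (ρ:ℂ)) ≠ 0 := by
        intro h0
        have := congrArg Complex.re h0
        simp at this
      rw [Complex.mk_eq_add_mul_I]
      push_cast
      have hf : (1 + (ρ:ℂ) ^ 2) = (1 - Complex.I * ρ) * (1 + Complex.I * ρ) := by
        linear_combination (ρ:ℂ) ^ 2 * Complex.I_sq
      field_simp
      have h2 := Complex.I_sq
      have h3 : Complex.I ^ 3 = -Complex.I := by rw [pow_succ, h2]; ring
      ring_nf
      simp only [h2, h3]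
      ring
    rw [Complex.imCLM_apply, him, Complex.im_ofReal_mul, hs]
    dsimp only
    field_simp
    ring

lemma tsum_nat_alternating {b : ℝ} (hb : 0 < b) :
    ∑' k : ℕ, (-1:ℝ) ^ k * (2 * (k:ℝ) + 1) / ((2 * (k:ℝ) + 1) ^ 2 + b ^ 2) ^ 2
      = π ^ 2 / (16 * b) * (sech (π * b / 2) * Real.tanh (π * b / 2)) := by
  rw [← (hasSum_quarter_int hb).tsum_eq]
  refine tsum_nat_eq_tsum_int (fun m => ?_) fun m => ?_
  · push_cast
    rw [pow_mul]; norm_num; ring_nf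
  · rw [pow_succ, pow_mul, Int.cast_negSucc]
    push_cast
    norm_num
    congr 1 <;> ring

lemma summable_odd_rpow : Summable fun k : ℕ => (2 * (k:ℝ) + 1) ^ (-(3 / 2) : ℝ) := by
  have h := (Real.summable_nat_rpow (p := -(3 / 2))).mpr (by norm_num)
  have := h.comp_injective (i := fun k : ℕ => 2 * k + 1) fun a b h => by simpa using h
  refine this.congr fun k => ?_
  simp

lemma div_sq_le_rpow {l m x : ℝ} (hl : 0 < l) (hm : 0 < m) (hx : 0 < x) :
    l / (2 * l ^ 2 + x ^ 2 * m ^ 2) ^ 2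
      ≤ x ^ (-(3 / 2) : ℝ) * (m ^ (-(3 / 2) : ℝ) * l ^ (-(3 / 2) : ℝ)) := by
  set S := 2 * l ^ 2 + x ^ 2 * m ^ 2 with hS
  have hS0 : 0 < S := by positivity
  set s := Real.sqrt S with hs
  have hs0 : 0 < s := Real.sqrt_pos.mpr hS0
  have h1 : l ≤ s := Real.le_sqrt_of_sq_le (by rw [hS]; nlinarith [sq_nonneg l, sq_nonneg (x * m)])
  have h2 : x * m ≤ s := Real.le_sqrt_of_sq_le (by rw [hS]; nlinarith [sq_nonneg l])
  have hSs : S ^ 2 = s ^ 4 := by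
    rw [show s ^ 4 = (s ^ 2) ^ 2 by ring, hs, Real.sq_sqrt hS0.le]
  have h3 : (x * m) ^ (3 / 2 : ℝ) * l ^ (3 / 2 : ℝ) * l ≤ S ^ 2 := by
    calc _ ≤ s ^ (3 / 2 : ℝ) * s ^ (3 / 2 : ℝ) * s := by gcongr
      _ = S ^ 2 := by
        rw [hSs, ← Real.rpow_add hs0, show (3 / 2 + 3 / 2 : ℝ) = (3 : ℕ) by norm_num,
          Real.rpow_natCast]
        ring
  rw [Real.rpow_neg hx.le, Real.rpow_neg hm.le, Real.rpow_neg hl.le, ← mul_assoc, ← mul_inv,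
    ← mul_inv, ← Real.mul_rpow hx.le hm.le, div_le_iff₀ (by positivity)]
  have hq : 0 < (x * m) ^ (3 / 2 : ℝ) * l ^ (3 / 2 : ℝ) := by positivity
  rw [inv_mul_eq_div, le_div_iff₀ hq]
  linarith

lemma summable_F22 {x : ℝ} (hx : 0 < x) :
    Summable fun p : ℕ × ℕ => (-1:ℝ)^(p.1*(p.1+1)/2 + p.2) * (2*(p.2:ℝ)+1) /
      (2*(2*(p.2:ℝ)+1)^2 + x^2*(2*(p.1:ℝ)+1)^2)^2 := by
  have h := (summable_odd_rpow.mul_of_nonneg summable_odd_rpow (fun k => by positivity)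
    (fun k => by positivity)).mul_left (x ^ (-(3 / 2) : ℝ))
  refine Summable.of_norm_bounded h fun p => ?_
  rw [norm_div, norm_mul, norm_pow, norm_neg, norm_one, one_pow, one_mul, Real.norm_of_nonneg
    (by positivity), Real.norm_of_nonneg (by positivity)]
  exact div_sq_le_rpow (by positivity) (by positivity) hx

lemma F22_eq_quarterPrimitive {x : ℝ} (hx : 0 < x) :
    F22 x = 9 * π ^ 2 * Real.sqrt 2 / (64 * x) * quarterPrimitive (π * x / Real.sqrt 8) := by
  have h8 : Real.sqrt 8 = 2 * Real.sqrt 2 := by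
    rw [show (8:ℝ) = 2 ^ 2 * 2 by norm_num, Real.sqrt_mul (by norm_num), Real.sqrt_sq (by norm_num)]
  have h2 : 0 < Real.sqrt 2 := by positivity
  have h22 : Real.sqrt 2 ^ 2 = 2 := Real.sq_sqrt (by norm_num)
  have hπ := Real.pi_pos
  set y := π * x / Real.sqrt 8 with hy
  have hinner (n : ℕ) : ∑' k : ℕ, (-1:ℝ)^(n*(n+1)/2 + k) * (2*(k:ℝ)+1) /
      (2*(2*(k:ℝ)+1)^2 + x^2*(2*(n:ℝ)+1)^2)^2 = π ^ 2 * Real.sqrt 2 / (64 * x) *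
        ((-1:ℝ)^(n*(n+1)/2) / (2 * (n:ℝ) + 1) * (sech ((2 * (n:ℝ) + 1) * y)
          * Real.tanh ((2 * (n:ℝ) + 1) * y))) := by
    set m : ℝ := 2 * (n:ℝ) + 1 with hm
    have hm0 : 0 < m := by positivity
    have hb : 0 < x * m / Real.sqrt 2 := by positivity
    have e := tsum_nat_alternating hb
    have hmy : π * (x * m / Real.sqrt 2) / 2 = m * y := by
      rw [hy, h8]; field_simp
    rw [hmy] at e
    have e2 (k : ℕ) : (-1:ℝ)^(n*(n+1)/2 + k) * (2*(k:ℝ)+1) / (2*(2*(k:ℝ)+1)^2 + x^2*m^2)^2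
        = (-1:ℝ)^(n*(n+1)/2) / 4 * ((-1:ℝ) ^ k * (2 * (k:ℝ) + 1)
          / ((2 * (k:ℝ) + 1) ^ 2 + (x * m / Real.sqrt 2) ^ 2) ^ 2) := by
      have e3 : 2*(2*(k:ℝ)+1)^2 + x^2*m^2
          = 2 * ((2 * (k:ℝ) + 1) ^ 2 + (x * m / Real.sqrt 2) ^ 2) := by
        rw [div_pow, h22]; ring
      have : 0 < (2 * (k:ℝ) + 1) ^ 2 + (x * m / Real.sqrt 2) ^ 2 := by positivity
      rw [e3, pow_add]
      generalize (2 * (k:ℝ) + 1) ^ 2 + (x * m / Real.sqrt 2) ^ 2 = A at *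
      field_simp
      norm_num
    rw [tsum_congr e2, tsum_mul_left, e]
    field_simp
    ring
  rw [F22, (summable_F22 hx).tsum_prod, tsum_congr hinner, tsum_mul_left, quarterPrimitive,
    tsum_nat_eq_tsum_int (g := fun n : ℤ => (-1:ℝ) ^ n / (4 * n + 1)
      * (sech ((4 * n + 1) * y) * Real.tanh ((4 * n + 1) * y)))]
  · ring
  · intro m
    rw [neg_one_pow_triangle_even]
    push_cast
    ring_nf
  · intro m
    rw [neg_one_pow_triangle_odd, Int.cast_negSucc]
    push_cast
    have e1 : (4 * (-((m:ℝ) + 1)) + 1) = -(2 * (2 * (m:ℝ) + 1) + 1) := by ring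
    rw [e1, neg_mul, sech_neg, Real.tanh_neg, div_neg]
    ring

/-- `θ₃` as a function of `P = -log q`. -/
noncomputable def thetaThree (P : ℝ) : ℝ := ∑' n : ℤ, Real.exp (-((n:ℝ) ^ 2 * P))

/-- `θ₄` as a function of `P = -log q`. -/
noncomputable def thetaFour (P : ℝ) : ℝ := ∑' n : ℤ, (-1:ℝ) ^ n * Real.exp (-((n:ℝ) ^ 2 * P))

lemma abs_intCast_le_sq (n : ℤ) : |(n:ℝ)| ≤ (n:ℝ) ^ 2 := by
  have h : |n| ≤ n ^ 2 := by
    rw [← sq_abs, sq]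
    rcases eq_or_ne n 0 with rfl | hn
    · simp
    · exact le_mul_of_one_le_left (abs_nonneg n) (Int.one_le_abs hn)
  exact_mod_cast h

lemma summable_thetaThree {P : ℝ} (hP : 0 < P) :
    Summable fun n : ℤ => Real.exp (-((n:ℝ) ^ 2 * P)) := by
  refine Summable.of_nonneg_of_le (fun n => (Real.exp_pos _).le) (fun n => ?_) (summable_int_exp hP)
  have := abs_intCast_le_sq n
  gcongr

lemma summable_norm_thetaFour {P : ℝ} (hP : 0 < P) :
    Summable fun n : ℤ => ‖(-1:ℝ) ^ n * Real.exp (-((n:ℝ) ^ 2 * P))‖ := by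
  refine (summable_thetaThree hP).congr fun n => ?_
  rw [norm_mul, Real.norm_eq_abs, abs_neg_one_zpow_real, one_mul, Real.norm_of_nonneg
    (Real.exp_pos _).le]

lemma phiR_exp (P : ℝ) : phiR (Real.exp (-P)) = thetaThree P := by
  refine tsum_congr fun n => ?_
  rw [← Real.rpow_intCast, ← Real.exp_mul]
  push_cast
  ring_nf

lemma phiR_neg_exp (P : ℝ) : phiR (-Real.exp (-P)) = thetaFour P := by
  refine tsum_congr fun n => ?_
  rw [neg_eq_neg_one_mul, mul_zpow, ← Real.rpow_intCast (Real.exp (-P)), ← Real.exp_mul]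
  congr 1
  · rw [sq, zpow_mul]
    rcases Int.even_or_odd n with h | h
    · rw [h.neg_one_zpow, one_zpow]
    · rw [h.neg_one_zpow, h.neg_one_zpow]
  · push_cast
    ring_nf

lemma tsum_eq_tsum_add_sub {F : ℤ × ℤ → ℝ} (hF : ∀ p, Odd (p.1 + p.2) → F p = 0) :
    ∑' p, F p = ∑' p : ℤ × ℤ, F (p.1 + p.2, p.1 - p.2) := by
  refine (Function.Injective.tsum_eq (g := fun p : ℤ × ℤ => (p.1 + p.2, p.1 - p.2)) ?_ ?_).symm
  · rintro ⟨a, b⟩ ⟨c, d⟩ h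
    simp only [Prod.mk.injEq] at h ⊢
    omega
  · rintro ⟨a, b⟩ h
    have he : Even (a + b) := by
      by_contra hcon
      exact h (hF (a, b) (Int.not_even_iff_odd.mp hcon))
    obtain ⟨c, hc⟩ := he
    exact ⟨(c, c - b), by simp only [Prod.mk.injEq]; omega⟩

lemma neg_one_zpow_mul_self (n : ℤ) : (-1:ℝ) ^ n * (-1) ^ n = 1 := by
  rw [← mul_zpow]; simp

lemma neg_one_zpow_add_odd {m n : ℤ} (h : Odd (m + n)) : (-1:ℝ) ^ m = -(-1) ^ n := by
  have e := h.neg_one_zpow (α := ℝ)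
  rw [zpow_add₀ (by norm_num)] at e
  linear_combination (-1:ℝ) ^ n * e - (-1:ℝ) ^ m * neg_one_zpow_mul_self n

lemma exp_add_sub_sq (s t P : ℝ) :
    Real.exp (-((s + t) ^ 2 * P)) * Real.exp (-((s - t) ^ 2 * P))
      = Real.exp (-(s ^ 2 * (2 * P))) * Real.exp (-(t ^ 2 * (2 * P))) := by
  rw [← Real.exp_add, ← Real.exp_add]
  ring_nf

lemma thetaThree_sq_add {P : ℝ} (hP : 0 < P) :
    thetaThree P ^ 2 + thetaFour P ^ 2 = 2 * thetaThree (2 * P) ^ 2 := by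
  have h2 : 0 < 2 * P := by positivity
  have s3 := (summable_thetaThree hP).norm
  have s4 := summable_norm_thetaFour hP
  have s32 := (summable_thetaThree h2).norm
  rw [sq, sq, sq, thetaThree, thetaFour, thetaThree, tsum_mul_tsum_of_summable_norm s3 s3,
    tsum_mul_tsum_of_summable_norm s4 s4, tsum_mul_tsum_of_summable_norm s32 s32,
    ← (summable_mul_of_summable_norm s3 s3).tsum_add (summable_mul_of_summable_norm s4 s4),
    tsum_eq_tsum_add_sub, ← tsum_mul_left]
  · refine tsum_congr fun p => ?_
    rw [← exp_add_sub_sq]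
    push_cast
    have e : (-1:ℝ) ^ (p.1 + p.2) * (-1) ^ (p.1 - p.2) = 1 := by
      rw [← zpow_add₀ (by norm_num), show p.1 + p.2 + (p.1 - p.2) = 2 * p.1 by ring, zpow_mul]
      norm_num
    generalize Real.exp (-(((p.1:ℝ) + p.2) ^ 2 * P)) = A
    generalize Real.exp (-(((p.1:ℝ) - p.2) ^ 2 * P)) = B
    linear_combination A * B * e
  · intro p hp
    rw [neg_one_zpow_add_odd hp]
    linear_combination (-(Real.exp (-((p.1:ℝ) ^ 2 * P)) * Real.exp (-((p.2:ℝ) ^ 2 * P))))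
      * neg_one_zpow_mul_self p.2

lemma thetaThree_mul_thetaFour {P : ℝ} (hP : 0 < P) :
    thetaThree P * thetaFour P = thetaFour (2 * P) ^ 2 := by
  have h2 : 0 < 2 * P := by positivity
  have s3 := (summable_thetaThree hP).norm
  have s4 := summable_norm_thetaFour hP
  have s42 := summable_norm_thetaFour h2
  have key : thetaThree P * thetaFour P + thetaFour P * thetaThree P
      = 2 * (thetaFour (2 * P) * thetaFour (2 * P)) := by
    rw [thetaThree, thetaFour, thetaFour, tsum_mul_tsum_of_summable_norm s3 s4,
      tsum_mul_tsum_of_summable_norm s4 s3, tsum_mul_tsum_of_summable_norm s42 s42,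
      ← (summable_mul_of_summable_norm s3 s4).tsum_add (summable_mul_of_summable_norm s4 s3),
      tsum_eq_tsum_add_sub, ← tsum_mul_left]
    · refine tsum_congr fun p => ?_
      have e := exp_add_sub_sq p.1 p.2 P
      push_cast
      have e1 : (-1:ℝ) ^ (p.1 + p.2) = (-1) ^ p.1 * (-1) ^ p.2 := zpow_add₀ (by norm_num) _ _
      have e2 : (-1:ℝ) ^ (p.1 - p.2) = (-1) ^ p.1 * (-1) ^ p.2 := by
        rw [← e1, zpow_sub₀ (by norm_num), zpow_add₀ (by norm_num), div_eq_mul_inv, ← inv_zpow]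
        norm_num
      rw [e1, e2]
      linear_combination 2 * ((-1:ℝ) ^ p.1 * (-1) ^ p.2) * e
    · intro p hp
      rw [neg_one_zpow_add_odd hp]
      ring
  linarith

lemma thetaThree_pos {P : ℝ} (hP : 0 < P) : 0 < thetaThree P :=
  (summable_thetaThree hP).tsum_pos (fun _ => (Real.exp_pos _).le) 0 (Real.exp_pos _)

lemma expDecay_exp_neg_abs : ExpDecay fun t => Real.exp (-|t|) :=
  ⟨1, zero_le_one, fun t => by rw [abs_of_pos (Real.exp_pos _), one_mul]⟩

lemma exp_neg_abs_sq_mul (n : ℤ) {P : ℝ} (hP : 0 < P) :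
    Real.exp (-|(n:ℝ) ^ 2 * P|) = Real.exp (-((n:ℝ) ^ 2 * P)) := by
  rw [abs_of_nonneg (by positivity)]

lemma tendsto_theta_aux {w : ℤ → ℝ} (hw : ∀ n, |w n| = 1) (h0 : w 0 = 1) :
    Tendsto (fun P => ∑' n : ℤ, w n * Real.exp (-((n:ℝ) ^ 2 * P))) atTop (𝓝 1) := by
  have h := expDecay_exp_neg_abs.tendsto_exp_mul_tsum (c := fun n => (n:ℝ) ^ 2)
    (w := w) (L := fun n => if n = 0 then 1 else 0) (k := 0) (A := 1)
    (fun n => abs_nonneg _)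
    (fun n => by rw [abs_of_nonneg (sq_nonneg (n:ℝ))]; linarith [abs_intCast_le_sq n])
    (fun n => by rw [hw]; linarith [abs_nonneg (n:ℝ)])
    (fun n hn => ?_) (fun n hn => ?_)
  · rw [tsum_ite_eq] at h
    refine h.congr' ?_
    filter_upwards [eventually_gt_atTop 0] with P hP
    rw [zero_mul, Real.exp_zero, one_mul]
    refine tsum_congr fun n => ?_
    rw [exp_neg_abs_sq_mul n hP]
  · have hn0 : n = 0 := by simpa using hn
    subst hn0
    simp [h0]
  · rw [if_neg]
    rintro rfl
    simp at hn

lemma tendsto_thetaThree : Tendsto thetaThree atTop (𝓝 1) := by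
  have := tendsto_theta_aux (w := fun _ => 1) (by simp) rfl
  simp only [one_mul] at this
  exact this

lemma tendsto_thetaFour : Tendsto thetaFour atTop (𝓝 1) :=
  tendsto_theta_aux (w := fun n => (-1:ℝ) ^ n) abs_neg_one_zpow_real (by simp)

lemma tendsto_exp_mul_theta_sub :
    Tendsto (fun P => Real.exp P * (thetaThree P - thetaFour P)) atTop (𝓝 4) := by
  have hpos (n : ℤ) : (0:ℝ) < if n = 0 then 1 else (n:ℝ) ^ 2 := by
    split_ifs with h
    · norm_num
    · positivity
  have hge (n : ℤ) (hn : n ≠ 0) : (1:ℝ) ≤ (n:ℝ) ^ 2 := by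
    have : (1:ℝ) ≤ |(n:ℝ)| := by exact_mod_cast Int.one_le_abs hn
    exact this.trans (abs_intCast_le_sq n)
  have h := expDecay_exp_neg_abs.tendsto_exp_mul_tsum
    (c := fun n => if n = 0 then 1 else (n:ℝ) ^ 2)
    (w := fun n => 1 - (-1) ^ n) (L := fun n => if n = 1 ∨ n = -1 then 2 else 0) (k := 1) (A := 2)
    (fun n => ?_) (fun n => ?_) (fun n => ?_) (fun n hn => ?_) (fun n hn => ?_)
  · rw [tsum_eq_sum (s := {1, -1}) (fun n hn => by
      rw [if_neg]; simpa using hn), Finset.sum_pair (by norm_num)] at h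
    norm_num at h
    refine h.congr' ?_
    filter_upwards [eventually_gt_atTop 0] with P hP
    congr 1
    rw [thetaThree, thetaFour, ← (summable_thetaThree hP).tsum_sub (summable_norm_thetaFour hP).of_norm]
    refine tsum_congr fun n => ?_
    rcases eq_or_ne n 0 with rfl | hn
    · simp
    · rw [if_neg hn, exp_neg_abs_sq_mul n hP]
      ring
  · rw [abs_of_pos (hpos n)]
    split_ifs with h
    · exact le_rfl
    · exact hge n h
  · rw [abs_of_pos (hpos n)]
    split_ifs with h
    · simp [h]
    · linarith [abs_intCast_le_sq n]
  · have h1 := abs_sub (1:ℝ) ((-1) ^ n)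
    rw [abs_neg_one_zpow_real, abs_one] at h1
    linarith [abs_nonneg (n:ℝ)]
  · rcases eq_or_ne n 0 with rfl | h0
    · simp
    · rw [abs_of_pos (hpos n), if_neg h0] at hn
      have hn1 : n = 1 ∨ n = -1 := by
        have : n ^ 2 = 1 := by exact_mod_cast hn
        have h2 : (n - 1) * (n + 1) = 0 := by linear_combination this
        rcases mul_eq_zero.mp h2 with h | h <;> omega
      rw [if_pos hn1]
      refine tendsto_const_nhds.congr' ?_
      filter_upwards [eventually_gt_atTop 0] with P hP
      have hw : (-1:ℝ) ^ n = -1 := by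
        rcases hn1 with rfl | rfl <;> norm_num
      rw [if_neg h0, hn, hw, one_mul, abs_of_pos hP, mul_left_comm, ← Real.exp_add]
      norm_num
  · rw [if_neg]
    rintro (rfl | rfl) <;> norm_num at hn

/-- `θ₄²/θ₃²` as a function of `P = -log q`. -/
noncomputable def thetaRatio (P : ℝ) : ℝ := thetaFour P ^ 2 / thetaThree P ^ 2

lemma thetaRatio_nonneg (P : ℝ) : 0 ≤ thetaRatio P := by unfold thetaRatio; positivity

lemma thetaRatio_double_sq {P : ℝ} (hP : 0 < P) :
    thetaRatio (2 * P) ^ 2 = 4 * thetaRatio P / (1 + thetaRatio P) ^ 2 := by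
  have h3 := thetaThree_pos hP
  have h1 : thetaThree (2 * P) ^ 2 = (thetaThree P ^ 2 + thetaFour P ^ 2) / 2 := by
    linarith [thetaThree_sq_add hP]
  rw [thetaRatio, thetaRatio, ← thetaThree_mul_thetaFour hP, h1]
  have : 0 < thetaThree P ^ 2 + thetaFour P ^ 2 := by positivity
  field_simp
  norm_num

lemma tendsto_thetaRatio : Tendsto thetaRatio atTop (𝓝 1) := by
  have := (tendsto_thetaFour.pow 2).div (tendsto_thetaThree.pow 2) (by norm_num)
  norm_num at this
  exact this

lemma tendsto_exp_mul_one_sub_thetaRatio :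
    Tendsto (fun P => Real.exp P * (1 - thetaRatio P)) atTop (𝓝 8) := by
  have h := (tendsto_exp_mul_theta_sub.mul (tendsto_thetaThree.add tendsto_thetaFour)).div
    (tendsto_thetaThree.pow 2) (by norm_num)
  norm_num at h
  refine h.congr' ?_
  filter_upwards [eventually_gt_atTop 0] with P hP
  have h3 := thetaThree_pos hP
  simp only [thetaRatio, Pi.div_apply]
  field_simp
  ring

lemma tendsto_exp_mul_one_sub_sechRatio :
    Tendsto (fun P => Real.exp P * (1 - sechRatio P)) atTop (𝓝 8) := by
  have h := (tendsto_exp_mul_sechOddSum.const_mul 2).div tendsto_sechSum (by norm_num)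
  norm_num at h
  refine h.congr' ?_
  filter_upwards [eventually_gt_atTop 0] with P hP
  have h3 := sechSum_pos hP
  have h4 := sechSum_eq_add hP
  have h5 : sechAltSum P = sechSum (2 * P) - sechOddSum P := rfl
  simp only [sechRatio, Pi.div_apply]
  field_simp
  linear_combination h5 - h4

lemma thetaRatio_pos {P : ℝ} (hP : 0 < P) : 0 < thetaRatio P := by
  refine pos_of_double (fun P hP h => ?_) (tendsto_thetaRatio.eventually (lt_mem_nhds one_pos)) hP
  refine lt_of_le_of_ne (thetaRatio_nonneg P) fun h0 => ?_
  have := thetaRatio_double_sq hP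
  rw [← h0] at this
  norm_num at this
  exact h.ne' this

lemma thetaRatio_lt_one {P : ℝ} (hP : 0 < P) : thetaRatio P < 1 := by
  have hle {P : ℝ} (hP : 0 < P) : thetaRatio P ≤ 1 := by
    have h := thetaRatio_double_sq (half_pos hP)
    rw [mul_div_cancel₀ _ two_ne_zero] at h
    have h0 := thetaRatio_nonneg (P / 2)
    have : thetaRatio P ^ 2 ≤ 1 := by
      rw [h, div_le_one (by positivity)]
      nlinarith [sq_nonneg (1 - thetaRatio (P / 2))]
    nlinarith [thetaRatio_nonneg P]
  suffices 0 < 1 - thetaRatio P by linarith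
  refine pos_of_double (g := fun P => 1 - thetaRatio P) (fun P hP h => ?_) ?_ hP
  · refine lt_of_le_of_ne (sub_nonneg.mpr (hle hP)) fun h0 => ?_
    have h1 : thetaRatio P = 1 := by linarith
    have h2 := thetaRatio_double_sq hP
    rw [h1] at h2
    norm_num at h2
    have := thetaRatio_nonneg (2 * P)
    rcases h2 with h2 | h2 <;> linarith
  · filter_upwards [tendsto_exp_mul_one_sub_thetaRatio.eventually
      (lt_mem_nhds (show (0:ℝ) < 8 by norm_num))] with P hP
    exact (pos_iff_pos_of_mul_pos hP).mp (Real.exp_pos P)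

/-- One step of the Landen transformation increases `(1 - u)/(1 - v)` when `u < v`. -/
lemma landen_step {u v u' v' : ℝ} (hu : 0 < u) (huv : u < v) (hv : v < 1) (hu' : 0 < u')
    (hv' : 0 < v') (eu : u' ^ 2 = 4 * u / (1 + u) ^ 2) (ev : v' ^ 2 = 4 * v / (1 + v) ^ 2) :
    u' < v' ∧ (1 - u) * (1 - v') ≤ (1 - u') * (1 - v) := by
  have hv0 : 0 < v := hu.trans huv
  have key {u u' : ℝ} (hu : 0 < u) (hu' : 0 < u') (eu : u' ^ 2 = 4 * u / (1 + u) ^ 2) :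
      u' = 2 * Real.sqrt u / (1 + Real.sqrt u ^ 2) := by
    have hs := Real.sqrt_pos.mpr hu
    rw [← pow_left_inj₀ hu'.le (by positivity) two_ne_zero, eu, div_pow, mul_pow,
      Real.sq_sqrt hu.le]
    norm_num
  rw [key hu hu' eu, key hv0 hv' ev]
  have e1 := Real.sq_sqrt hu.le
  have e2 := Real.sq_sqrt hv0.le
  have h3 : Real.sqrt u < Real.sqrt v := Real.sqrt_lt_sqrt hu.le huv
  have h4 : Real.sqrt v < 1 := by rw [Real.sqrt_lt' one_pos]; simpa using hv
  have h5 := Real.sqrt_pos.mpr hu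
  rw [show 1 - u = 1 - Real.sqrt u ^ 2 by rw [e1], show 1 - v = 1 - Real.sqrt v ^ 2 by rw [e2]]
  generalize Real.sqrt u = s at *
  generalize Real.sqrt v = t at *
  have ht : 0 < t := h5.trans h3
  constructor
  · rw [div_lt_div_iff₀ (by positivity) (by positivity)]
    have : 0 < (t - s) * (1 - s * t) := mul_pos (by linarith) (by nlinarith)
    nlinarith
  · have a1 : 1 - 2 * t / (1 + t ^ 2) = (1 - t) ^ 2 / (1 + t ^ 2) := by field_simp; ring
    have a2 : 1 - 2 * s / (1 + s ^ 2) = (1 - s) ^ 2 / (1 + s ^ 2) := by field_simp; ring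
    rw [a1, a2, mul_div_assoc', div_mul_eq_mul_div, div_le_div_iff₀ (by positivity) (by positivity)]
    have b : (1 + s) * (1 - t) * (1 + s ^ 2) ≤ (1 - s) * (1 + t) * (1 + t ^ 2) := by
      have c1 : (1 + s) * (1 - t) ≤ (1 - s) * (1 + t) := by nlinarith
      have c2 : 1 + s ^ 2 ≤ 1 + t ^ 2 := by nlinarith
      exact mul_le_mul c1 c2 (by positivity) (by nlinarith)
    have d : 0 ≤ (1 - s) * (1 - t) := by nlinarith
    calc _ = ((1 - s) * (1 - t)) * ((1 + s) * (1 - t) * (1 + s ^ 2)) := by ring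
      _ ≤ ((1 - s) * (1 - t)) * ((1 - s) * (1 + t) * (1 + t ^ 2)) :=
        mul_le_mul_of_nonneg_left b d
      _ = _ := by ring

/-- A solution of the Landen recursion is determined by its behaviour at infinity. -/
lemma landen_le {u v : ℝ → ℝ} {L : ℝ} (hL : 0 < L) (hu : ∀ P, 0 < P → 0 < u P)
    (hv : ∀ P, 0 < P → 0 < v P) (hv1 : ∀ P, 0 < P → v P < 1)
    (du : ∀ P, 0 < P → u (2 * P) ^ 2 = 4 * u P / (1 + u P) ^ 2)
    (dv : ∀ P, 0 < P → v (2 * P) ^ 2 = 4 * v P / (1 + v P) ^ 2)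
    (lu : Tendsto (fun P => Real.exp P * (1 - u P)) atTop (𝓝 L))
    (lv : Tendsto (fun P => Real.exp P * (1 - v P)) atTop (𝓝 L)) {P : ℝ} (hP : 0 < P) :
    v P ≤ u P := by
  by_contra! hlt
  have ind (n : ℕ) : u (2 ^ n * P) < v (2 ^ n * P) ∧
      (1 - u P) * (1 - v (2 ^ n * P)) ≤ (1 - u (2 ^ n * P)) * (1 - v P) := by
    induction n with
    | zero => simpa using hlt
    | succ n ih =>
      have hQ : 0 < 2 ^ n * P := by positivity
      rw [pow_succ', mul_assoc]
      generalize 2 ^ n * P = Q at *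
      have h2Q : 0 < 2 * Q := by positivity
      have st := landen_step (hu Q hQ) ih.1 (hv1 Q hQ) (hu _ h2Q) (hv _ h2Q) (du Q hQ) (dv Q hQ)
      refine ⟨st.1, ?_⟩
      have k1 := sub_pos.mpr (hv1 Q hQ)
      have k2 := sub_pos.mpr (hv1 _ h2Q)
      have k3 := sub_pos.mpr (hv1 P hP)
      refine le_of_mul_le_mul_left ?_ k1
      nlinarith [mul_le_mul_of_nonneg_left ih.2 k2.le, mul_le_mul_of_nonneg_left st.2 k3.le]
  have h2 : Tendsto (fun n : ℕ => (2:ℝ) ^ n * P) atTop atTop :=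
    (tendsto_pow_atTop_atTop_of_one_lt (by norm_num)).atTop_mul_const hP
  have hle := le_of_tendsto_of_tendsto' ((lv.comp h2).const_mul (1 - u P))
    ((lu.comp h2).mul_const (1 - v P)) fun n => by
      have := mul_le_mul_of_nonneg_left (ind n).2 (Real.exp_pos (2 ^ n * P)).le
      simp only [Function.comp]
      linarith
  nlinarith

lemma thetaRatio_eq_sechRatio {P : ℝ} (hP : 0 < P) : thetaRatio P = sechRatio P :=
  le_antisymm
    (landen_le (by norm_num) (fun _ => sechRatio_pos) (fun _ => thetaRatio_pos)
      (fun _ => thetaRatio_lt_one) (fun _ => sechRatio_double_sq) (fun _ => thetaRatio_double_sq)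
      tendsto_exp_mul_one_sub_sechRatio tendsto_exp_mul_one_sub_thetaRatio hP)
    (landen_le (by norm_num) (fun _ => thetaRatio_pos) (fun _ => sechRatio_pos)
      (fun _ => sechRatio_lt_one) (fun _ => thetaRatio_double_sq) (fun _ => sechRatio_double_sq)
      tendsto_exp_mul_one_sub_thetaRatio tendsto_exp_mul_one_sub_sechRatio hP)

/-- For `x > 0`, with `q = e^{-πx/√8}` and `α = φ(-q²)²/φ(q²)²`, one has `0 < α < 1` and
`F_{(2,2)}(x) = (9π²/(256x)) ∫_α^1 (3u-1)/√(u(1-u)) · ₂F₁(1/2,1/2;1;1-u²) du`. -/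
theorem stmt_12 (x : ℝ) (hx : 0 < x) (q : ℝ) (hq : q = Real.exp (-π*x/Real.sqrt 8))
    (α : ℝ) (hα : α = phiR (-q^2)^2 / phiR (q^2)^2) :
    (0 < α ∧ α < 1) ∧
    F22 x = 9*π^2/(256*x) *
      ∫ u in α..1, (3*u-1)/Real.sqrt (u*(1-u)) * hyp2F1half (1-u^2) := by
  have hy : 0 < π * x / Real.sqrt 8 := by positivity
  have h2y : 0 < 2 * (π * x / Real.sqrt 8) := by positivity
  have hq2 : q ^ 2 = Real.exp (-(2 * (π * x / Real.sqrt 8))) := by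
    rw [hq, ← Real.exp_nat_mul]
    push_cast
    ring_nf
  have hα' : α = sechRatio (2 * (π * x / Real.sqrt 8)) := by
    rw [hα, hq2, phiR_exp, phiR_neg_exp, ← thetaRatio_eq_sechRatio h2y, thetaRatio]
  refine ⟨⟨hα' ▸ sechRatio_pos h2y, hα' ▸ sechRatio_lt_one h2y⟩, ?_⟩
  have hI := integral_sechRatio_eq hy
  rw [← hα'] at hI
  simp only [landenIntegrand] at hI
  rw [hI, F22_eq_quarterPrimitive hx]
  field_simp
  ring
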